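/- There exists a Jordan domain Ω in ℝ² whose boundary is a chord-arc curve with flatness ζ_{∂Ω} = 1/2 such that the associated surface Σ(Ω, t^α) is not quasisymmetric to the unit sphere S² for any α ∈ (0,1). -/

import Mathlib

open Metric Set MeasureTheory

noncomputable section

/-- The Euclidean plane. -/
abbrev E2 : Type := EuclideanSpace ℝ (Fin 2)
/-- Euclidean three-space. -/
abbrev E3 : Type := EuclideanSpace ℝ (Fin 3)

/-- Build a point of ℝ³ from a planar point and a height. -/
def mk3 (x : E2) (z : ℝ) : E3 := (WithLp.equiv 2 (Fin 3 → ℝ)).symm ![x 0, x 1, z]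

/-- A Jordan curve: the image of the unit circle under a continuous injection
(equivalently, a topological embedding, by compactness of the circle). -/
def IsJordanCurve (Γ : Set E2) : Prop :=
  ∃ f : E2 → E2, ContinuousOn f (sphere 0 1) ∧ InjOn f (sphere 0 1) ∧ f '' (sphere 0 1) = Γ

/-- A Jordan domain: a bounded domain whose boundary is a Jordan curve. -/
def IsJordanDomain (Ω : Set E2) : Prop :=
  IsOpen Ω ∧ IsConnected Ω ∧ Bornology.IsBounded Ω ∧ IsJordanCurve (frontier Ω)

/-- The ε-level set γ_ε = {x ∈ Ω : dist(x,∂Ω) = ε}, with the convention γ₀ = ∂Ω. -/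
def levelSet (Ω : Set E2) (ε : ℝ) : Set E2 :=
  if ε = 0 then frontier Ω else {x ∈ Ω | infDist x (frontier Ω) = ε}

/-- The double-dome-like surface Σ(Ω,φ). -/
def domeSurface (Ω : Set E2) (φ : ℝ → ℝ) : Set E3 :=
  {p | ∃ x ∈ closure Ω, p = mk3 x (φ (infDist x (frontier Ω))) ∨
                        p = mk3 x (-φ (infDist x (frontier Ω)))}

/-- The class 𝓕 of gauges: homeomorphisms φ of [0,∞) onto [0,∞) with φ(0)=0,
liminf_{t→0} φ(t)/t > 0, and φ Lipschitz on [r,∞) for every r > 0. -/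
structure GaugeF (φ : ℝ → ℝ) : Prop where
  continuousOn : ContinuousOn φ (Ici 0)
  strictMonoOn : StrictMonoOn φ (Ici 0)
  surjOn : SurjOn φ (Ici 0) (Ici 0)
  map_zero : φ 0 = 0
  liminf_pos : ∃ m > (0:ℝ), ∀ᶠ t in nhdsWithin 0 (Ioi 0), m * t ≤ φ t
  lipschitzOn : ∀ r > (0:ℝ), ∃ L : NNReal, LipschitzOnWith L φ (Ici r)

/-- A subarc of Γ with endpoints x and y: a subset of Γ that is a simple arc from x to y. -/
def IsSubarc (Γ A : Set E2) (x y : E2) : Prop :=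
  A ⊆ Γ ∧ ∃ f : ℝ → E2, ContinuousOn f (Icc 0 1) ∧ InjOn f (Icc 0 1) ∧
    f 0 = x ∧ f 1 = y ∧ f '' (Icc 0 1) = A

/-- The 2-point condition with constant C: for any two points of Γ, some subarc joining
them (hence the one of smaller diameter) has diameter at most C·|x−y|. -/
def TwoPointCondition (Γ : Set E2) (C : ℝ) : Prop :=
  ∀ x ∈ Γ, ∀ y ∈ Γ, x ≠ y →
    ∃ A, IsSubarc Γ A x y ∧ Metric.diam A ≤ C * dist x y

/-- A c-chord-arc curve: a rectifiable Jordan curve such that for any two points, the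
shorter subarc joining them has length (1-dimensional Hausdorff measure) at most c·|x−y|. -/
def IsChordArc (Γ : Set E2) (c : ℝ) : Prop :=
  IsJordanCurve Γ ∧ μH[1] Γ < ⊤ ∧
  ∀ x ∈ Γ, ∀ y ∈ Γ, x ≠ y →
    ∃ A, IsSubarc Γ A x y ∧ μH[1] A ≤ ENNReal.ofReal (c * dist x y)

/-- The λ-LLC₁ condition. -/
def LLC1With {X : Type*} [MetricSpace X] (S : Set X) (lam : ℝ) : Prop :=
  ∀ x ∈ S, ∀ r > (0:ℝ), ∀ y₁ ∈ ball x r ∩ S, ∀ y₂ ∈ ball x r ∩ S,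
    ∃ E ⊆ ball x (lam * r) ∩ S, IsCompact E ∧ IsConnected E ∧ y₁ ∈ E ∧ y₂ ∈ E

/-- The λ-LLC₂ condition. -/
def LLC2With {X : Type*} [MetricSpace X] (S : Set X) (lam : ℝ) : Prop :=
  ∀ x ∈ S, ∀ r > (0:ℝ), ∀ y₁ ∈ S \ ball x r, ∀ y₂ ∈ S \ ball x r,
    ∃ E ⊆ S \ ball x (r / lam), IsCompact E ∧ IsConnected E ∧ y₁ ∈ E ∧ y₂ ∈ E

/-- λ-linear local connectivity. -/
def LLCWith {X : Type*} [MetricSpace X] (S : Set X) (lam : ℝ) : Prop :=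
  LLC1With S lam ∧ LLC2With S lam

/-- S (with the Euclidean metric of ℝ³) is quasisymmetric to the unit sphere S²:
there are a homeomorphism η of [0,∞) onto itself and an η-quasisymmetric
homeomorphism of S onto the unit sphere. -/
def QSEquivSphere (S : Set E3) : Prop :=
  ∃ η : ℝ → ℝ, (ContinuousOn η (Ici 0) ∧ StrictMonoOn η (Ici 0) ∧ SurjOn η (Ici 0) (Ici 0)) ∧
  ∃ f : S → (sphere (0:E3) 1 : Set E3), Function.Bijective f ∧
    ∀ (x a b : S) (t : ℝ), 0 < t → dist (x:E3) a ≤ t * dist (x:E3) b →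
      dist (f x : E3) (f a) ≤ η t * dist (f x : E3) (f b)

/-- The level chord-arc property. -/
def LevelChordArc (Ω : Set E2) : Prop :=
  ∃ ε₀ > (0:ℝ), ∃ c > (1:ℝ), ∀ ε, 0 ≤ ε → ε ≤ ε₀ → IsChordArc (levelSet Ω ε) c

/-- The level quasicircle property. -/
def LevelQuasicircle (Ω : Set E2) : Prop :=
  ∃ ε₀ > (0:ℝ), ∃ C > (1:ℝ), ∀ ε, 0 ≤ ε → ε ≤ ε₀ →
    IsJordanCurve (levelSet Ω ε) ∧ TwoPointCondition (levelSet Ω ε) C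

/-- The line through x and y. -/
def lineThrough (x y : E2) : Set E2 := (affineSpan ℝ {x, y} : Set E2)

/-- ζ_Γ(x,y): the normalized maximal deviation from the chord, over the subarc of Γ
joining x and y of smallest diameter (either one in case of a tie). -/
def pairFlatness (Γ : Set E2) (x y : E2) : ℝ :=
  (dist x y)⁻¹ * sInf {s | ∃ A, IsSubarc Γ A x y ∧
      (∀ B, IsSubarc Γ B x y → Metric.diam A ≤ Metric.diam B) ∧
      s = sSup ((fun z => infDist z (lineThrough x y)) '' A)}

/-- The flatness ζ_Γ = lim_{r→0} sup_{x,y∈Γ, |x−y|≤r} ζ_Γ(x,y); the limit of the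
monotone quantity is realized as the infimum over r > 0. -/
def flatness (Γ : Set E2) : ℝ :=
  sInf {s | ∃ r > (0:ℝ),
    s = sSup {h | ∃ x ∈ Γ, ∃ y ∈ Γ, x ≠ y ∧ dist x y ≤ r ∧ h = pairFlatness Γ x y}}


/-! ### The circular bump and its variation function -/

/-- The lower semicircle of radius `h`, extended by zero. -/
def arcBump (h u : ℝ) : ℝ := -√(h ^ 2 - u ^ 2)

/-- An increasing function dominating the variation of `arcBump h`, equal to the identity
outside the bump. -/
def arcVar (h u : ℝ) : ℝ :=
  if h ≤ |u| then u else if u ≤ 0 then √(h ^ 2 - u ^ 2) - h else h - √(h ^ 2 - u ^ 2)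

lemma arcBump_eq_zero {h u : ℝ} (hh : 0 ≤ h) (hu : h ≤ |u|) : arcBump h u = 0 := by
  have : h ^ 2 ≤ u ^ 2 := by rw [← sq_abs u]; gcongr
  simp [arcBump, Real.sqrt_eq_zero_of_nonpos (sub_nonpos.2 this)]

lemma arcVar_eq_self {h u : ℝ} (hu : h ≤ |u|) : arcVar h u = u := by
  simp [arcVar, hu]

lemma arcBump_nonpos (h u : ℝ) : arcBump h u ≤ 0 := by
  simp [arcBump]

lemma neg_le_arcBump {h : ℝ} (hh : 0 ≤ h) (u : ℝ) : -h ≤ arcBump h u := by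
  simp only [arcBump, neg_le_neg_iff]
  exact Real.sqrt_le_iff.2 ⟨hh, by nlinarith [sq_nonneg u]⟩

lemma continuous_arcBump (h : ℝ) : Continuous (arcBump h) := by
  unfold arcBump; fun_prop

lemma sub_abs_le_sqrt (h u : ℝ) : h - |u| ≤ √(h ^ 2 - u ^ 2) := by
  rcases le_total h |u| with hu | hu
  · exact (sub_nonpos.2 hu).trans (Real.sqrt_nonneg _)
  · apply Real.le_sqrt_of_sq_le
    nlinarith [sq_abs u, abs_nonneg u]

lemma sqrt_le_radius {h : ℝ} (hh : 0 ≤ h) (u : ℝ) : √(h ^ 2 - u ^ 2) ≤ h :=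
  Real.sqrt_le_iff.2 ⟨hh, by nlinarith [sq_nonneg u]⟩

lemma arcBump_sub_le_arcVar_sub {h : ℝ} (hh : 0 ≤ h) {x y : ℝ} (hxy : x ≤ y) :
    |arcBump h y - arcBump h x| ≤ arcVar h y - arcVar h x := by
  have hx0 := Real.sqrt_nonneg (h ^ 2 - x ^ 2)
  have hy0 := Real.sqrt_nonneg (h ^ 2 - y ^ 2)
  have hx1 := sqrt_le_radius hh x
  have hy1 := sqrt_le_radius hh y
  have mono1 : y ≤ 0 → √(h ^ 2 - x ^ 2) ≤ √(h ^ 2 - y ^ 2) := fun hy =>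
    Real.sqrt_le_sqrt (by nlinarith)
  have mono2 : 0 ≤ x → √(h ^ 2 - y ^ 2) ≤ √(h ^ 2 - x ^ 2) := fun hx =>
    Real.sqrt_le_sqrt (by nlinarith)
  have zx : h ≤ |x| → √(h ^ 2 - x ^ 2) = 0 := fun hx => by
    simpa [arcBump] using arcBump_eq_zero hh hx
  have zy : h ≤ |y| → √(h ^ 2 - y ^ 2) = 0 := fun hy => by
    simpa [arcBump] using arcBump_eq_zero hh hy
  rw [abs_le]
  unfold arcBump arcVar
  split_ifs with h1 h2 h3 h4 h5 h6 <;>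
  simp only [not_le, le_abs'] at * <;> constructor <;> grind

lemma arcVar_sub_le {h : ℝ} (hh : 0 ≤ h) {x y : ℝ} (hxy : x ≤ y) :
    arcVar h y - arcVar h x ≤ 2 * (y - x) + |arcBump h y - arcBump h x| := by
  have hx0 := Real.sqrt_nonneg (h ^ 2 - x ^ 2)
  have hy0 := Real.sqrt_nonneg (h ^ 2 - y ^ 2)
  have hx1 := sqrt_le_radius hh x
  have hy1 := sqrt_le_radius hh y
  have hx2 := sub_abs_le_sqrt h x
  have hy2 := sub_abs_le_sqrt h y
  have zx : h ≤ |x| → √(h ^ 2 - x ^ 2) = 0 := fun hx => by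
    simpa [arcBump] using arcBump_eq_zero hh hx
  have zy : h ≤ |y| → √(h ^ 2 - y ^ 2) = 0 := fun hy => by
    simpa [arcBump] using arcBump_eq_zero hh hy
  have a1 := le_abs_self (-√(h ^ 2 - y ^ 2) - -√(h ^ 2 - x ^ 2))
  have a2 := neg_le_abs (-√(h ^ 2 - y ^ 2) - -√(h ^ 2 - x ^ 2))
  unfold arcBump arcVar
  split_ifs with h1 h2 h3 h4 h5 h6 <;> grind

lemma abs_arcVar_sub_self_le {h : ℝ} (hh : 0 ≤ h) (u : ℝ) : |arcVar h u - u| ≤ h := by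
  have hx0 := Real.sqrt_nonneg (h ^ 2 - u ^ 2)
  have hx1 := sqrt_le_radius hh u
  have hx2 := sub_abs_le_sqrt h u
  unfold arcVar
  rw [abs_le]
  split_ifs with h1 h2 <;> constructor <;> grind

/-- Thales' theorem for ordered points on a semicircle extended by its diameter line. -/
lemma thales_arcBump {h : ℝ} (hh : 0 < h) {s u t : ℝ} (hsu : s ≤ u) (hut : u ≤ t) :
    (s - u) * (t - u) + (arcBump h s - arcBump h u) * (arcBump h t - arcBump h u) ≤ 0 := by
  have key : ∀ {s u t : ℝ}, s ≤ u → u ≤ t → -h ≤ s → t ≤ h →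
      (s - u) * (t - u) +
        (arcBump h s - arcBump h u) * (arcBump h t - arcBump h u) ≤ 0 := by
    intro s u t hsu hut hs ht
    have par : ∀ x, -h ≤ x → x ≤ h →
        x = h * Real.sin (Real.arcsin (x / h)) ∧
        arcBump h x = -(h * Real.cos (Real.arcsin (x / h))) := by
      intro x hx1 hx2
      have h1 : -1 ≤ x / h := by rw [le_div_iff₀ hh]; linarith
      have h2 : x / h ≤ 1 := by rw [div_le_iff₀ hh]; linarith
      refine ⟨by rw [Real.sin_arcsin h1 h2]; field_simp, ?_⟩
      rw [Real.cos_arcsin, arcBump]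
      have : h ^ 2 - x ^ 2 = h ^ 2 * (1 - (x / h) ^ 2) := by field_simp
      rw [this, Real.sqrt_mul (by positivity), Real.sqrt_sq hh.le]
    obtain ⟨s1, s2⟩ := par s hs (by linarith)
    obtain ⟨u1, u2⟩ := par u (by linarith) (by linarith)
    obtain ⟨t1, t2⟩ := par t (by linarith) ht
    have hab : Real.arcsin (s / h) ≤ Real.arcsin (u / h) :=
      Real.monotone_arcsin (by gcongr)
    have hbc : Real.arcsin (u / h) ≤ Real.arcsin (t / h) :=
      Real.monotone_arcsin (by gcongr)
    have ha := Real.neg_pi_div_two_le_arcsin (s / h)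
    have hc := Real.arcsin_le_pi_div_two (t / h)
    rw [s2, u2, t2]
    generalize Real.arcsin (s / h) = a at *
    generalize Real.arcsin (u / h) = b at *
    generalize Real.arcsin (t / h) = c at *
    rw [s1, u1, t1]
    have e1 : (h * Real.sin a - h * Real.sin b) * (h * Real.sin c - h * Real.sin b) +
        (-(h * Real.cos a) - -(h * Real.cos b)) * (-(h * Real.cos c) - -(h * Real.cos b))
        = h ^ 2 * (4 * (Real.sin ((a - b) / 2) * Real.sin ((c - b) / 2) *
          Real.cos ((a - c) / 2))) := by
      have := Real.sin_sub_sin a b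
      have := Real.sin_sub_sin c b
      have := Real.cos_sub_cos a b
      have := Real.cos_sub_cos c b
      have h5 : Real.cos ((a - c) / 2) = Real.cos ((a + b) / 2) * Real.cos ((c + b) / 2) +
          Real.sin ((a + b) / 2) * Real.sin ((c + b) / 2) := by
        rw [← Real.cos_sub]; ring_nf
      calc _ = h ^ 2 * ((Real.sin a - Real.sin b) * (Real.sin c - Real.sin b) +
            (Real.cos a - Real.cos b) * (Real.cos c - Real.cos b)) := by ring
        _ = _ := by simp only [*]; ring
    rw [e1]
    have i1 : Real.sin ((a - b) / 2) ≤ 0 :=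
      Real.sin_nonpos_of_nonpos_of_neg_pi_le (by linarith) (by linarith)
    have i2 : 0 ≤ Real.sin ((c - b) / 2) :=
      Real.sin_nonneg_of_nonneg_of_le_pi (by linarith) (by linarith)
    have i3 : 0 ≤ Real.cos ((a - c) / 2) :=
      Real.cos_nonneg_of_neg_pi_div_two_le_of_le (by linarith) (by linarith)
    have i4 := mul_nonneg (mul_nonneg (neg_nonneg.2 i1) i2) i3
    nlinarith [mul_nonneg (sq_nonneg h) i4]
  by_cases hu : h ≤ |u|
  · rw [arcBump_eq_zero hh.le hu, sub_zero, sub_zero]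
    have h1 : (s - u) * (t - u) ≤ 0 := by nlinarith
    rcases le_abs'.1 hu with hu | hu
    · rw [arcBump_eq_zero hh.le (le_abs'.2 (Or.inl (hsu.trans hu)))]; linarith
    · rw [arcBump_eq_zero hh.le (u := t) (le_abs'.2 (Or.inr (hu.trans hut)))]; linarith
  · rw [not_le, abs_lt] at hu
    have cs : arcBump h s = arcBump h (max s (-h)) := by
      rcases le_total s (-h) with h1 | h1
      · rw [max_eq_right h1, arcBump_eq_zero hh.le (le_abs'.2 (Or.inl h1)),
          arcBump_eq_zero hh.le (by simp [le_abs_self])]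
      · rw [max_eq_left h1]
    have ct : arcBump h t = arcBump h (min t h) := by
      rcases le_total h t with h1 | h1
      · rw [min_eq_right h1, arcBump_eq_zero hh.le (le_abs'.2 (Or.inr h1)),
          arcBump_eq_zero hh.le (by simp [le_abs_self])]
      · rw [min_eq_left h1]
    have := key (s := max s (-h)) (u := u) (t := min t h) (max_le hsu hu.1.le)
      (le_min hut hu.2.le) (le_max_right _ _) (min_le_right _ _)
    rw [cs, ct]
    have m1 : s ≤ max s (-h) := le_max_left _ _
    have m2 : min t h ≤ t := min_le_left _ _
    have m3 : max s (-h) ≤ u := max_le hsu hu.1.le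
    have m4 : u ≤ min t h := le_min hut hu.2.le
    nlinarith [mul_nonneg (sub_nonneg.2 m1) (sub_nonneg.2 hut),
      mul_nonneg (sub_nonneg.2 m2) (sub_nonneg.2 m3)]

/-! ### The profile: infinitely many disjoint bumps -/

/-- Radii of the bumps. -/
def bumpRadius (n : ℕ) : ℝ := 1 / 32 * (1 / 4) ^ n

/-- Centres of the bumps. -/
def bumpCenter (n : ℕ) : ℝ := 1 / 2 + 5 * bumpRadius n

/-- The profile of the lower side. -/
def profile (x : ℝ) : ℝ := ∑' n, arcBump (bumpRadius n) (x - bumpCenter n)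

/-- An increasing function dominating the variation of the profile. -/
def profileVar (x : ℝ) : ℝ :=
  x + ∑' n, (arcVar (bumpRadius n) (x - bumpCenter n) - (x - bumpCenter n))

/-- The point `x` belongs to the (open) base of the `n`-th bump. -/
def InBump (n : ℕ) (x : ℝ) : Prop := |x - bumpCenter n| < bumpRadius n

/-- At `x` only the `k`-th bump may contribute to the profile. -/
def OnlyBump (k : ℕ) (x : ℝ) : Prop :=
  profile x = arcBump (bumpRadius k) (x - bumpCenter k) ∧
    profileVar x = bumpCenter k + arcVar (bumpRadius k) (x - bumpCenter k)

lemma bumpRadius_pos (n : ℕ) : 0 < bumpRadius n := by unfold bumpRadius; positivity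

lemma bumpRadius_le (n : ℕ) : bumpRadius n ≤ 1 / 32 := by
  have : (1 / 4 : ℝ) ^ n ≤ 1 := pow_le_one₀ (by norm_num) (by norm_num)
  unfold bumpRadius; linarith

lemma bumpRadius_four_mul_le {m n : ℕ} (h : m < n) : 4 * bumpRadius n ≤ bumpRadius m := by
  have : (1 / 4 : ℝ) ^ n ≤ (1 / 4) ^ (m + 1) :=
    pow_le_pow_of_le_one (by norm_num) (by norm_num) h
  rw [pow_succ] at this
  unfold bumpRadius; linarith

lemma InBump.gap {m n : ℕ} {x y : ℝ} (hx : InBump m x) (hy : InBump n y) (hmn : m ≠ n) :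
    2 * bumpRadius m ≤ |x - y| ∧ 2 * bumpRadius n ≤ |x - y| := by
  unfold InBump at hx hy
  rw [abs_lt] at hx hy
  unfold bumpCenter at hx hy
  have hm := bumpRadius_pos m
  have hn := bumpRadius_pos n
  rcases hmn.lt_or_gt with h | h
  · have := bumpRadius_four_mul_le h
    constructor <;> exact le_trans (by linarith) (le_abs_self _)
  · have := bumpRadius_four_mul_le h
    constructor <;> exact le_trans (by linarith) (neg_le_abs _)

lemma InBump.unique {m n : ℕ} {x : ℝ} (hm : InBump m x) (hn : InBump n x) : m = n := by
  by_contra h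
  have := (hm.gap hn h).1
  simp only [sub_self, abs_zero] at this
  linarith [bumpRadius_pos m]

lemma InBump.mem_Icc {n : ℕ} {x : ℝ} (h : InBump n x) : x ∈ Icc (1 / 2 : ℝ) (3 / 4) := by
  unfold InBump bumpCenter at h
  rw [abs_lt] at h
  have := bumpRadius_pos n
  have := bumpRadius_le n
  constructor <;> linarith

lemma InBump.onlyBump {n : ℕ} {x : ℝ} (h : InBump n x) : OnlyBump n x := by
  have far : ∀ k, k ≠ n → bumpRadius k ≤ |x - bumpCenter k| := fun k hk => by
    by_contra hc
    exact hk (InBump.unique (not_le.1 hc) h)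
  constructor
  · exact tsum_eq_single n fun k hk => arcBump_eq_zero (bumpRadius_pos k).le (far k hk)
  · unfold profileVar
    rw [tsum_eq_single n fun k hk => by rw [arcVar_eq_self (far k hk), sub_self]]
    ring

lemma onlyBump_of_not_inBump {x : ℝ} (h : ∀ n, ¬ InBump n x) (k : ℕ) : OnlyBump k x := by
  have far : ∀ k, bumpRadius k ≤ |x - bumpCenter k| := fun k => not_lt.1 (h k)
  constructor
  · unfold profile
    rw [arcBump_eq_zero (bumpRadius_pos k).le (far k)]
    simp [fun k => arcBump_eq_zero (bumpRadius_pos k).le (far k)]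
  · unfold profileVar
    rw [arcVar_eq_self (far k)]
    simp [fun k => arcVar_eq_self (far k)]

lemma profile_eq_zero_of_not_inBump {x : ℝ} (h : ∀ n, ¬ InBump n x) : profile x = 0 := by
  rw [(onlyBump_of_not_inBump h 0).1]
  exact arcBump_eq_zero (bumpRadius_pos 0).le (not_lt.1 (h 0))

lemma profile_nonpos (x : ℝ) : profile x ≤ 0 := tsum_nonpos fun _ => arcBump_nonpos _ _

lemma InBump.abs_profile_le {n : ℕ} {x : ℝ} (h : InBump n x) : |profile x| ≤ bumpRadius n := by
  rw [abs_of_nonpos (profile_nonpos x), h.onlyBump.1]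
  linarith [neg_le_arcBump (bumpRadius_pos n).le (x - bumpCenter n)]

lemma profile_ge (x : ℝ) : -(1 / 32) ≤ profile x := by
  by_cases h : ∃ n, InBump n x
  · obtain ⟨n, hn⟩ := h
    have := (abs_le.1 hn.abs_profile_le).1
    linarith [bumpRadius_le n]
  · rw [profile_eq_zero_of_not_inBump (not_exists.1 h)]; norm_num

lemma profile_eq_zero {x : ℝ} (h : x < 1 / 2 ∨ 3 / 4 < x) : profile x = 0 :=
  profile_eq_zero_of_not_inBump fun n hn => by
    rcases h with h | h
    · exact absurd hn.mem_Icc.1 (not_le.2 h)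
    · exact absurd hn.mem_Icc.2 (not_le.2 h)

lemma continuous_profile : Continuous profile := by
  refine continuous_tsum (u := bumpRadius)
    (fun n => (continuous_arcBump _).comp (by fun_prop)) ?_ fun n x => ?_
  · exact (summable_geometric_of_lt_one (by norm_num) (by norm_num)).mul_left _
  · rw [Real.norm_eq_abs, abs_of_nonpos (arcBump_nonpos _ _)]
    linarith [neg_le_arcBump (bumpRadius_pos n).le (x - bumpCenter n)]

lemma onlyBump_or_gap (x y : ℝ) : (∃ k, OnlyBump k x ∧ OnlyBump k y) ∨
    ∃ m n, m ≠ n ∧ InBump m x ∧ InBump n y := by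
  by_cases hx : ∃ m, InBump m x
  · obtain ⟨m, hm⟩ := hx
    by_cases hy : ∃ n, InBump n y
    · obtain ⟨n, hn⟩ := hy
      by_cases h : m = n
      · subst h; exact Or.inl ⟨m, hm.onlyBump, hn.onlyBump⟩
      · exact Or.inr ⟨m, n, h, hm, hn⟩
    · exact Or.inl ⟨m, hm.onlyBump, onlyBump_of_not_inBump (not_exists.1 hy) m⟩
  · by_cases hy : ∃ n, InBump n y
    · obtain ⟨n, hn⟩ := hy
      exact Or.inl ⟨n, onlyBump_of_not_inBump (not_exists.1 hx) n, hn.onlyBump⟩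
    · exact Or.inl ⟨0, onlyBump_of_not_inBump (not_exists.1 hx) 0,
        onlyBump_of_not_inBump (not_exists.1 hy) 0⟩

lemma profile_sub_le_profileVar_sub {x y : ℝ} (hxy : x ≤ y) :
    |profile y - profile x| ≤ profileVar y - profileVar x := by
  rcases onlyBump_or_gap x y with ⟨k, hx, hy⟩ | ⟨m, n, hmn, hx, hy⟩
  · rw [hx.1, hx.2, hy.1, hy.2, add_sub_add_left_eq_sub]
    exact arcBump_sub_le_arcVar_sub (bumpRadius_pos k).le (by linarith)
  · have gap : bumpCenter m + bumpRadius m ≤ bumpCenter n - bumpRadius n := by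
      have h1 := hx
      have h2 := hy
      unfold InBump at h1 h2
      rw [abs_lt] at h1 h2
      have hm := bumpRadius_pos m
      have hn := bumpRadius_pos n
      unfold bumpCenter at *
      rcases hmn.lt_or_gt with h | h <;> have := bumpRadius_four_mul_le h <;> linarith
    have h1 := hx
    have h2 := hy
    unfold InBump at h1 h2
    rw [abs_lt] at h1 h2
    have k1 := arcBump_sub_le_arcVar_sub (bumpRadius_pos m).le h1.2.le
    have k2 := arcBump_sub_le_arcVar_sub (bumpRadius_pos n).le h2.1.le
    rw [arcVar_eq_self (u := bumpRadius m) (le_abs_self _),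
      arcBump_eq_zero (u := bumpRadius m) (bumpRadius_pos m).le (le_abs_self _), zero_sub,
      abs_neg, ← hx.onlyBump.1] at k1
    rw [arcVar_eq_self (u := -bumpRadius n) (by simp [le_abs_self]),
      arcBump_eq_zero (u := -bumpRadius n) (bumpRadius_pos n).le (by simp [le_abs_self]),
      sub_zero, ← hy.onlyBump.1] at k2
    have := abs_sub (profile y) (profile x)
    rw [hx.onlyBump.2, hy.onlyBump.2]
    linarith

lemma profileVar_sub_le {x y : ℝ} (hxy : x ≤ y) :
    profileVar y - profileVar x ≤ 2 * (y - x) + |profile y - profile x| := by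
  rcases onlyBump_or_gap x y with ⟨k, hx, hy⟩ | ⟨m, n, hmn, hx, hy⟩
  · rw [hx.1, hx.2, hy.1, hy.2, add_sub_add_left_eq_sub]
    have := arcVar_sub_le (bumpRadius_pos k).le (x := x - bumpCenter k) (y := y - bumpCenter k)
      (by linarith)
    linarith
  · have k1 := (abs_le.1 (abs_arcVar_sub_self_le (bumpRadius_pos m).le (x - bumpCenter m))).1
    have k2 := (abs_le.1 (abs_arcVar_sub_self_le (bumpRadius_pos n).le (y - bumpCenter n))).2
    have g := hx.gap hy hmn
    rw [abs_sub_comm, abs_of_nonneg (sub_nonneg.2 hxy)] at g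
    rw [hx.onlyBump.2, hy.onlyBump.2]
    linarith [g.1, g.2, abs_nonneg (profile y - profile x)]

lemma abs_profile_le_of_inBump_ne {m n : ℕ} {x y : ℝ} (hmn : m ≠ n) (hx : InBump m x)
    (hy : InBump n y) : |profile x| ≤ |x - y| / 2 ∧ |profile y| ≤ |x - y| / 2 := by
  have g := hx.gap hy hmn
  exact ⟨hx.abs_profile_le.trans (by linarith), hy.abs_profile_le.trans (by linarith)⟩

lemma onlyBump_or_abs_profile_le {s u t : ℝ} (hsu : s ≤ u) (hut : u ≤ t) :
    (∃ k, OnlyBump k s ∧ OnlyBump k u ∧ OnlyBump k t) ∨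
    (|profile s| ≤ (t - s) / 2 ∧ |profile u| ≤ (t - s) / 2 ∧ |profile t| ≤ (t - s) / 2) := by
  have ground : ∀ x, (∀ n, ¬ InBump n x) → |profile x| ≤ (t - s) / 2 := fun x hx => by
    rw [profile_eq_zero_of_not_inBump hx, abs_zero]; linarith
  have pair : ∀ {m n : ℕ} {x y : ℝ}, m ≠ n → InBump m x → InBump n y → s ≤ x → x ≤ t → s ≤ y →
      y ≤ t → |profile x| ≤ (t - s) / 2 ∧ |profile y| ≤ (t - s) / 2 := by
    intro m n x y hmn hx hy h1 h2 h3 h4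
    have := abs_profile_le_of_inBump_ne hmn hx hy
    have h5 : |x - y| ≤ t - s := abs_le.2 ⟨by linarith, by linarith⟩
    constructor <;> linarith [this.1, this.2]
  have third : ∀ {m n : ℕ} {x y : ℝ} (z : ℝ), m ≠ n → InBump m x → InBump n y → s ≤ x → x ≤ t →
      s ≤ y → y ≤ t → s ≤ z → z ≤ t → |profile z| ≤ (t - s) / 2 := by
    intro m n x y z hmn hx hy h1 h2 h3 h4 h5 h6
    by_cases hz : ∃ p, InBump p z
    · obtain ⟨p, hp⟩ := hz
      by_cases hpm : p = m
      · subst hpm; exact (pair hmn hp hy h5 h6 h3 h4).1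
      · exact (pair hpm hp hx h5 h6 h1 h2).1
    · exact ground z (not_exists.1 hz)
  have all : ∀ {m n : ℕ} {x y : ℝ}, m ≠ n → InBump m x → InBump n y → s ≤ x → x ≤ t →
      s ≤ y → y ≤ t →
      (|profile s| ≤ (t - s) / 2 ∧ |profile u| ≤ (t - s) / 2 ∧ |profile t| ≤ (t - s) / 2) :=
    fun hmn hx hy h1 h2 h3 h4 =>
      ⟨third s hmn hx hy h1 h2 h3 h4 le_rfl (by linarith), third u hmn hx hy h1 h2 h3 h4 hsu hut,
        third t hmn hx hy h1 h2 h3 h4 (by linarith) le_rfl⟩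
  by_cases hs : ∃ k, InBump k s
  · obtain ⟨k, hk⟩ := hs
    rcases onlyBump_or_gap s t with - | ⟨m, n, hmn, hx, hy⟩
    · by_cases h1 : OnlyBump k u
      · by_cases h2 : OnlyBump k t
        · exact Or.inl ⟨k, hk.onlyBump, h1, h2⟩
        · obtain ⟨n, hn⟩ := not_forall_not.1 fun h => h2 (onlyBump_of_not_inBump h k)
          exact Or.inr (all (by rintro rfl; exact h2 hn.onlyBump) hk hn (by linarith) (by linarith)
            (by linarith) (by linarith))
      · obtain ⟨n, hn⟩ := not_forall_not.1 fun h => h1 (onlyBump_of_not_inBump h k)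
        exact Or.inr (all (by rintro rfl; exact h1 hn.onlyBump) hk hn (by linarith) (by linarith)
            (by linarith) (by linarith))
    · exact Or.inr (all hmn hx hy (by linarith) (by linarith) (by linarith) (by linarith))
  · have hs' := onlyBump_of_not_inBump (not_exists.1 hs)
    rcases onlyBump_or_gap u t with ⟨k, h1, h2⟩ | ⟨m, n, hmn, hx, hy⟩
    · exact Or.inl ⟨k, hs' k, h1, h2⟩
    · exact Or.inr (all hmn hx hy (by linarith) (by linarith) (by linarith) (by linarith))


/-! ### Subarcs of Jordan curves -/

lemma IsSubarc.symm {Γ A : Set E2} {x y : E2} (h : IsSubarc Γ A x y) : IsSubarc Γ A y x := by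
  obtain ⟨hA, f, hf, hinj, h0, h1, him⟩ := h
  have hmaps : MapsTo (fun t : ℝ => 1 - t) (Icc 0 1) (Icc 0 1) := fun t ht =>
    ⟨by linarith [ht.2], by linarith [ht.1]⟩
  refine ⟨hA, fun t => f (1 - t), hf.comp (by fun_prop) hmaps, ?_, by simpa, by simpa, ?_⟩
  · intro a ha b hb hab
    have := hinj (hmaps ha) (hmaps hb) hab
    linarith
  · rw [← him]
    ext z
    constructor
    · rintro ⟨t, ht, rfl⟩
      exact ⟨1 - t, hmaps ht, rfl⟩
    · rintro ⟨t, ht, rfl⟩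
      exact ⟨1 - t, hmaps ht, by simp⟩

lemma isSubarc_comm {Γ A : Set E2} {x y : E2} : IsSubarc Γ A x y ↔ IsSubarc Γ A y x :=
  ⟨IsSubarc.symm, IsSubarc.symm⟩

lemma IsSubarc.isCompact {Γ A : Set E2} {x y : E2} (h : IsSubarc Γ A x y) : IsCompact A := by
  obtain ⟨-, f, hf, -, -, -, rfl⟩ := h
  exact isCompact_Icc.image_of_continuousOn hf

lemma IsSubarc.isPreconnected {Γ A : Set E2} {x y : E2} (h : IsSubarc Γ A x y) :
    IsPreconnected A := by
  obtain ⟨-, f, hf, -, -, -, rfl⟩ := h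
  exact isPreconnected_Icc.image _ hf

lemma IsSubarc.left_mem {Γ A : Set E2} {x y : E2} (h : IsSubarc Γ A x y) : x ∈ A := by
  obtain ⟨-, f, -, -, rfl, -, rfl⟩ := h
  exact ⟨0, by simp, rfl⟩

lemma IsSubarc.right_mem {Γ A : Set E2} {x y : E2} (h : IsSubarc Γ A x y) : y ∈ A :=
  h.symm.left_mem

lemma isSubarc_image_Icc {Γ : Set E2} {P : ℝ → E2} {s t : ℝ} (hst : s < t)
    (hc : ContinuousOn P (Icc s t)) (hinj : InjOn P (Icc s t)) (hΓ : ∀ u ∈ Icc s t, P u ∈ Γ) :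
    IsSubarc Γ (P '' Icc s t) (P s) (P t) := by
  have hpos : 0 < t - s := sub_pos.2 hst
  have hmaps : MapsTo (fun u : ℝ => s + u * (t - s)) (Icc 0 1) (Icc s t) := fun u hu =>
    ⟨by nlinarith [hu.1], by nlinarith [hu.2]⟩
  refine ⟨by rintro _ ⟨u, hu, rfl⟩; exact hΓ u hu, fun u => P (s + u * (t - s)),
    hc.comp (by fun_prop) hmaps, ?_, by simp, by simp, ?_⟩
  · intro a ha b hb hab
    have := hinj (hmaps ha) (hmaps hb) hab
    exact mul_right_cancel₀ hpos.ne' (add_left_cancel this)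
  · ext z
    constructor
    · rintro ⟨u, hu, rfl⟩
      exact ⟨_, hmaps hu, rfl⟩
    · rintro ⟨u, hu, rfl⟩
      refine ⟨(u - s) / (t - s), ⟨by apply div_nonneg <;> linarith [hu.1], ?_⟩, ?_⟩
      · rw [div_le_one hpos]; linarith [hu.2]
      · simp only
        rw [div_mul_cancel₀ _ hpos.ne']; simp

/-- The standard parametrization of the unit circle. -/
def circlePoint (θ : ℝ) : E2 := !₂[Real.cos θ, Real.sin θ]

lemma continuous_circlePoint : Continuous circlePoint := by
  unfold circlePoint; fun_prop

lemma circlePoint_mem (θ : ℝ) : circlePoint θ ∈ sphere (0 : E2) 1 := by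
  rw [mem_sphere_zero_iff_norm, EuclideanSpace.norm_eq]
  simp [circlePoint, Fin.sum_univ_two]

lemma exists_circlePoint_eq {u : E2} (hu : u ∈ sphere (0 : E2) 1) :
    ∃ θ, circlePoint θ = u := by
  rw [mem_sphere_zero_iff_norm, EuclideanSpace.norm_eq, Real.sqrt_eq_one] at hu
  simp only [Real.norm_eq_abs, sq_abs, Fin.sum_univ_two] at hu
  have hn : ‖(⟨u 0, u 1⟩ : ℂ)‖ = 1 := by
    rw [Complex.norm_def, Complex.normSq_apply, Real.sqrt_eq_one]; linarith
  have hz : (⟨u 0, u 1⟩ : ℂ) ≠ 0 := by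
    intro h; rw [h] at hn; simp at hn
  refine ⟨Complex.arg ⟨u 0, u 1⟩, ?_⟩
  ext i
  fin_cases i
  · simp [circlePoint, Complex.cos_arg hz, hn]
  · simp [circlePoint, Complex.sin_arg, hn]

lemma circlePoint_add_two_pi (θ : ℝ) : circlePoint (θ + 2 * Real.pi) = circlePoint θ := by
  simp [circlePoint]

lemma injOn_circlePoint {a b : ℝ} (h : b - a < 2 * Real.pi) : InjOn circlePoint (Icc a b) := by
  intro x hx y hy hxy
  have hc : Real.cos x = Real.cos y := by simpa [circlePoint] using congrArg (fun p : E2 => p 0) hxy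
  have hs : Real.sin x = Real.sin y := by simpa [circlePoint] using congrArg (fun p : E2 => p 1) hxy
  have := Real.Angle.cos_sin_inj hc hs
  rw [Real.Angle.angle_eq_iff_two_pi_dvd_sub] at this
  obtain ⟨k, hk⟩ := this
  have hpi := Real.pi_pos
  have h1 : (k : ℝ) < 1 := by
    by_contra! hk1
    nlinarith [hx.1, hx.2, hy.1, hy.2]
  have h2 : (-1 : ℝ) < k := by
    by_contra! hk1
    nlinarith [hx.1, hx.2, hy.1, hy.2]
  have h3 : k = 0 := by
    have : k < 1 := by exact_mod_cast h1
    have : -1 < k := by exact_mod_cast h2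
    omega
  rw [h3] at hk
  simp at hk
  linarith

lemma exists_isSubarc {Γ : Set E2} (hΓ : IsJordanCurve Γ) {x y : E2} (hx : x ∈ Γ) (hy : y ∈ Γ)
    (hxy : x ≠ y) : ∃ A, IsSubarc Γ A x y := by
  obtain ⟨f, hf, hinj, rfl⟩ := hΓ
  obtain ⟨u, hu, rfl⟩ := hx
  obtain ⟨v, hv, rfl⟩ := hy
  obtain ⟨a, rfl⟩ := exists_circlePoint_eq hu
  obtain ⟨b, rfl⟩ := exists_circlePoint_eq hv
  obtain ⟨b', ⟨hb1, hb2⟩, hb'⟩ : ∃ b' ∈ Ico a (a + 2 * Real.pi), circlePoint b' = circlePoint b := by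
    have hper : Function.Periodic circlePoint (2 * Real.pi) := circlePoint_add_two_pi
    obtain ⟨c, hc, hcb⟩ := hper.exists_mem_Ico Real.two_pi_pos b a
    exact ⟨c, hc, hcb.symm⟩
  rw [← hb'] at hxy ⊢
  have hlt : a < b' := lt_of_le_of_ne hb1 (by rintro rfl; exact hxy rfl)
  refine ⟨_, isSubarc_image_Icc (P := fun θ => f (circlePoint θ)) hlt ?_ ?_ ?_⟩
  · exact hf.comp continuous_circlePoint.continuousOn fun θ _ => circlePoint_mem θ
  · intro p hp q hq hpq
    exact injOn_circlePoint (by linarith) hp hq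
      (hinj (circlePoint_mem p) (circlePoint_mem q) hpq)
  · exact fun θ _ => ⟨_, circlePoint_mem θ, rfl⟩

lemma lineThrough_comm (x y : E2) : lineThrough x y = lineThrough y x := by
  unfold lineThrough; rw [Set.pair_comm]

lemma left_mem_lineThrough (x y : E2) : x ∈ lineThrough x y :=
  left_mem_affineSpan_pair ℝ x y

lemma pairFlatness_comm (Γ : Set E2) (x y : E2) : pairFlatness Γ x y = pairFlatness Γ y x := by
  unfold pairFlatness
  simp only [lineThrough_comm x y, dist_comm x y, isSubarc_comm (x := x) (y := y)]

lemma pairFlatness_le_of_isBounded {Γ : Set E2} (hΓ : Bornology.IsBounded Γ) (x y : E2) :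
    pairFlatness Γ x y ≤ (dist x y)⁻¹ * Metric.diam Γ := by
  unfold pairFlatness
  refine mul_le_mul_of_nonneg_left ?_ (by positivity)
  set S := {s | ∃ A, IsSubarc Γ A x y ∧
      (∀ B, IsSubarc Γ B x y → Metric.diam A ≤ Metric.diam B) ∧
      s = sSup ((fun z => infDist z (lineThrough x y)) '' A)}
  have hbdd : BddBelow S := by
    refine ⟨0, ?_⟩
    rintro s ⟨A, -, -, rfl⟩
    exact Real.sSup_nonneg (by rintro _ ⟨z, -, rfl⟩; exact infDist_nonneg)
  rcases S.eq_empty_or_nonempty with h | ⟨s, hs⟩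
  · rw [h, Real.sInf_empty]; exact Metric.diam_nonneg
  · refine (csInf_le hbdd hs).trans ?_
    obtain ⟨A, hA, -, rfl⟩ := hs
    refine Real.sSup_le ?_ Metric.diam_nonneg
    rintro _ ⟨z, hz, rfl⟩
    exact (infDist_le_dist_of_mem (left_mem_lineThrough x y)).trans
      (dist_le_diam_of_mem hΓ (hA.1 hz) (hA.1 hA.left_mem))

/-! ### Curves with good charts -/

/-- A parametrized piece `P '' [lo, hi]` of `Γ` with inverse `ψ`, whose chords control the
increments of the monotone parameter `τ` and which deviates from each chord by at most half
of the length of the chord. -/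
structure IsChart (Γ : Set E2) (C : ℝ) (P : ℝ → E2) (ψ : E2 → ℝ) (τ : ℝ → ℝ) (lo hi : ℝ) :
    Prop where
  continuous : Continuous P
  continuous_coord : Continuous ψ
  coord : ∀ t ∈ Icc lo hi, ψ (P t) = t
  mem : ∀ t ∈ Icc lo hi, P t ∈ Γ
  dist_le : ∀ s ∈ Icc lo hi, ∀ t ∈ Icc lo hi, s ≤ t → dist (P s) (P t) ≤ τ t - τ s
  sub_le : ∀ s ∈ Icc lo hi, ∀ t ∈ Icc lo hi, s ≤ t → τ t - τ s ≤ C * dist (P s) (P t)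
  flat : ∀ s ∈ Icc lo hi, ∀ u ∈ Icc lo hi, ∀ t ∈ Icc lo hi, s ≤ u → u ≤ t →
    infDist (P u) (lineThrough (P s) (P t)) ≤ dist (P s) (P t) / 2

namespace IsChart

variable {Γ : Set E2} {C : ℝ} {P : ℝ → E2} {ψ : E2 → ℝ} {τ : ℝ → ℝ} {lo hi : ℝ}

lemma injOn (h : IsChart Γ C P ψ τ lo hi) : InjOn P (Icc lo hi) := fun a ha b hb hab => by
  rw [← h.coord a ha, ← h.coord b hb, hab]

lemma isSubarc (h : IsChart Γ C P ψ τ lo hi) {s t : ℝ} (hs : s ∈ Icc lo hi) (ht : t ∈ Icc lo hi)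
    (hst : s < t) : IsSubarc Γ (P '' Icc s t) (P s) (P t) :=
  isSubarc_image_Icc hst h.continuous.continuousOn (h.injOn.mono (Icc_subset_Icc hs.1 ht.2))
    fun u hu => h.mem u ⟨hs.1.trans hu.1, hu.2.trans ht.2⟩

lemma hausdorffMeasure_le (h : IsChart Γ C P ψ τ lo hi) {s t : ℝ} (hs : s ∈ Icc lo hi)
    (ht : t ∈ Icc lo hi) (hst : s ≤ t) :
    μH[1] (P '' Icc s t) ≤ ENNReal.ofReal (C * dist (P s) (P t)) := by
  have sub : Icc s t ⊆ Icc lo hi := Icc_subset_Icc hs.1 ht.2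
  have mono : ∀ a ∈ Icc lo hi, ∀ b ∈ Icc lo hi, a ≤ b → τ a ≤ τ b := fun a ha b hb hab => by
    linarith [h.dist_le a ha b hb hab, dist_nonneg (x := P a) (y := P b)]
  have hdist : ∀ a ∈ Icc lo hi, ∀ b ∈ Icc lo hi, dist (P a) (P b) ≤ dist (τ a) (τ b) := by
    intro a ha b hb
    rw [Real.dist_eq]
    rcases le_total a b with hab | hab
    · rw [abs_sub_comm]
      exact (h.dist_le a ha b hb hab).trans (le_abs_self _)
    · rw [dist_comm]
      exact (h.dist_le b hb a ha hab).trans (le_abs_self _)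
  have hτinj : ∀ a ∈ Icc lo hi, ∀ b ∈ Icc lo hi, τ a = τ b → P a = P b := fun a ha b hb hab => by
    have := hdist a ha b hb
    rw [hab, dist_self] at this
    exact dist_le_zero.1 this
  set g : ℝ → E2 := fun r => P (Function.invFunOn τ (Icc s t) r)
  have hg : ∀ a ∈ Icc s t, g (τ a) = P a := fun a ha => by
    have hm := Function.invFunOn_mem (f := τ) (s := Icc s t) ⟨a, ha, rfl⟩
    have he := Function.invFunOn_eq (f := τ) (s := Icc s t) ⟨a, ha, rfl⟩
    exact hτinj _ (sub hm) _ (sub ha) he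
  have hlip : LipschitzOnWith 1 g (τ '' Icc s t) := by
    refine LipschitzOnWith.of_dist_le_mul ?_
    rintro _ ⟨a, ha, rfl⟩ _ ⟨b, hb, rfl⟩
    rw [hg a ha, hg b hb, NNReal.coe_one, one_mul]
    exact hdist a (sub ha) b (sub hb)
  have himg : P '' Icc s t = g '' (τ '' Icc s t) := by
    rw [image_image]
    exact image_congr fun a ha => (hg a ha).symm
  calc μH[1] (P '' Icc s t) ≤ μH[1] (τ '' Icc s t) := by
        rw [himg]
        simpa using hlip.hausdorffMeasure_image_le (d := 1) zero_le_one
    _ ≤ μH[1] (Icc (τ s) (τ t)) := by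
        refine measure_mono ?_
        rintro _ ⟨a, ha, rfl⟩
        exact ⟨mono s hs a (sub ha) ha.1, mono a (sub ha) t ht ha.2⟩
    _ = ENNReal.ofReal (τ t - τ s) := by
        rw [hausdorffMeasure_real, Real.volume_Icc]
    _ ≤ _ := ENNReal.ofReal_le_ofReal (h.sub_le s hs t ht hst)

lemma diam_le (h : IsChart Γ C P ψ τ lo hi) {s t : ℝ} (hs : s ∈ Icc lo hi)
    (ht : t ∈ Icc lo hi) (hst : s ≤ t) :
    Metric.diam (P '' Icc s t) ≤ C * dist (P s) (P t) := by
  have sub : Icc s t ⊆ Icc lo hi := Icc_subset_Icc hs.1 ht.2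
  have mono : ∀ a ∈ Icc lo hi, ∀ b ∈ Icc lo hi, a ≤ b → τ a ≤ τ b := fun a ha b hb hab => by
    linarith [h.dist_le a ha b hb hab, dist_nonneg (x := P a) (y := P b)]
  have hle := h.sub_le s hs t ht hst
  have key : ∀ a ∈ Icc s t, ∀ b ∈ Icc s t, a ≤ b → dist (P a) (P b) ≤ C * dist (P s) (P t) := by
    intro a ha b hb hab
    linarith [h.dist_le a (sub ha) b (sub hb) hab, mono s hs a (sub ha) ha.1,
      mono b (sub hb) t ht hb.2]
  refine Metric.diam_le_of_forall_dist_le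
    (dist_nonneg.trans (key s ⟨le_rfl, hst⟩ t ⟨hst, le_rfl⟩ hst)) ?_
  rintro _ ⟨a, ha, rfl⟩ _ ⟨b, hb, rfl⟩
  rcases le_total a b with hab | hab
  · exact key a ha b hb hab
  · rw [dist_comm]; exact key b hb a ha hab

/-- A connected subset of `Γ` joining two points of a chart without leaving it contains the
part of the chart between them. -/
lemma image_subset (h : IsChart Γ C P ψ τ lo hi) {s t : ℝ} {B : Set E2}
    (hB : B ⊆ P '' Icc lo hi) (hconn : IsPreconnected B) (hs : s ∈ Icc lo hi)
    (ht : t ∈ Icc lo hi) (hsB : P s ∈ B) (htB : P t ∈ B) : P '' Icc s t ⊆ B := by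
  rintro _ ⟨u, hu, rfl⟩
  have hord := (hconn.image ψ h.continuous_coord.continuousOn).ordConnected
  have : u ∈ ψ '' B := hord.out ⟨P s, hsB, h.coord s hs⟩ ⟨P t, htB, h.coord t ht⟩ hu
  obtain ⟨b, hb, rfl⟩ := this
  obtain ⟨v, hv, rfl⟩ := hB hb
  rwa [h.coord v hv]

variable {r : ℝ} {x₀ : E2}

lemma image_subset_or_le_diam (h : IsChart Γ C P ψ τ lo hi)
    (hcov : ∀ y ∈ Γ, dist y x₀ < r → y ∈ P '' Icc lo hi) {s t : ℝ} (hs : s ∈ Icc lo hi)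
    (ht : t ∈ Icc lo hi) {B : Set E2} (hB : IsSubarc Γ B (P s) (P t)) (hx₀ : x₀ ∈ B) :
    P '' Icc s t ⊆ B ∨ r ≤ Metric.diam B := by
  by_cases hd : r ≤ Metric.diam B
  · exact Or.inr hd
  · refine Or.inl (h.image_subset (fun y hy => hcov y (hB.1 hy) ?_) hB.isPreconnected hs ht
      hB.left_mem hB.right_mem)
    exact (dist_le_diam_of_mem hB.isCompact.isBounded hy hx₀).trans_lt (not_le.1 hd)

lemma pairFlatness_le (h : IsChart Γ C P ψ τ lo hi)
    (hcov : ∀ y ∈ Γ, dist y x₀ < r → y ∈ P '' Icc lo hi) {s t : ℝ} (hs : s ∈ Icc lo hi)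
    (ht : t ∈ Icc lo hi) (hst : s < t) (hx₀ : x₀ = P s ∨ x₀ = P t)
    (hr : C * dist (P s) (P t) ≤ r) : pairFlatness Γ (P s) (P t) ≤ 1 / 2 := by
  have hpos : 0 < dist (P s) (P t) :=
    dist_pos.2 fun heq => hst.ne (h.injOn hs ht heq)
  unfold pairFlatness
  have hle : sInf {s_1 | ∃ A, IsSubarc Γ A (P s) (P t) ∧
      (∀ B, IsSubarc Γ B (P s) (P t) → Metric.diam A ≤ Metric.diam B) ∧
      s_1 = sSup ((fun z => infDist z (lineThrough (P s) (P t))) '' A)} ≤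
      dist (P s) (P t) / 2 := by
    refine le_trans (csInf_le ⟨0, ?_⟩
      ⟨P '' Icc s t, h.isSubarc hs ht hst, fun B hB => ?_, rfl⟩) ?_
    · rintro s ⟨A, -, -, rfl⟩
      exact Real.sSup_nonneg (by rintro _ ⟨z, -, rfl⟩; exact infDist_nonneg)
    · rcases h.image_subset_or_le_diam hcov hs ht hB
        (by rcases hx₀ with rfl | rfl; exacts [hB.left_mem, hB.right_mem]) with hsub | hd
      · exact Metric.diam_mono hsub hB.isCompact.isBounded
      · exact (h.diam_le hs ht hst.le).trans (hr.trans hd)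
    · refine Real.sSup_le ?_ (by positivity)
      rintro _ ⟨_, ⟨u, hu, rfl⟩, rfl⟩
      exact h.flat s hs u ⟨hs.1.trans hu.1, hu.2.trans ht.2⟩ t ht hu.1 hu.2
  calc _ ≤ (dist (P s) (P t))⁻¹ * (dist (P s) (P t) / 2) := by gcongr
    _ = 1 / 2 := by field_simp

lemma le_pairFlatness (h : IsChart Γ C P ψ τ lo hi)
    (hcov : ∀ y ∈ Γ, dist y x₀ < r → y ∈ P '' Icc lo hi) {s u t : ℝ} (hs : s ∈ Icc lo hi)
    (ht : t ∈ Icc lo hi) (hst : s < t) (hx₀ : x₀ = P s ∨ x₀ = P t) (hu : u ∈ Icc s t)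
    (hr : C * dist (P s) (P t) < r)
    (hdev : dist (P s) (P t) / 2 ≤ infDist (P u) (lineThrough (P s) (P t))) :
    1 / 2 ≤ pairFlatness Γ (P s) (P t) := by
  have hpos : 0 < dist (P s) (P t) :=
    dist_pos.2 fun heq => hst.ne (h.injOn hs ht heq)
  have mem_of : ∀ {B}, IsSubarc Γ B (P s) (P t) → x₀ ∈ B := fun hB => by
    rcases hx₀ with rfl | rfl; exacts [hB.left_mem, hB.right_mem]
  unfold pairFlatness
  have hle : dist (P s) (P t) / 2 ≤ sInf {s_1 | ∃ A, IsSubarc Γ A (P s) (P t) ∧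
      (∀ B, IsSubarc Γ B (P s) (P t) → Metric.diam A ≤ Metric.diam B) ∧
      s_1 = sSup ((fun z => infDist z (lineThrough (P s) (P t))) '' A)} := by
    refine le_csInf ⟨_, P '' Icc s t, h.isSubarc hs ht hst, fun B hB => ?_, rfl⟩ ?_
    · rcases h.image_subset_or_le_diam hcov hs ht hB (mem_of hB) with hsub | hd
      · exact Metric.diam_mono hsub hB.isCompact.isBounded
      · exact (h.diam_le hs ht hst.le).trans (hr.le.trans hd)
    · rintro _ ⟨A, hA, hmin, rfl⟩
      rcases h.image_subset_or_le_diam hcov hs ht hA (mem_of hA) with hsub | hd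
      · refine hdev.trans (le_csSup ?_ ⟨P u, hsub ⟨u, hu, rfl⟩, rfl⟩)
        exact (hA.isCompact.image (continuous_infDist_pt _)).bddAbove
      · have := hmin _ (h.isSubarc hs ht hst)
        linarith [h.diam_le hs ht hst.le]
  calc 1 / 2 = (dist (P s) (P t))⁻¹ * (dist (P s) (P t) / 2) := by field_simp
    _ ≤ _ := by gcongr

end IsChart

/-- Every ball of radius `r` centred on `Γ` meets `Γ` inside a single chart. -/
def HasCharts (Γ : Set E2) (C r : ℝ) : Prop :=
  ∀ x ∈ Γ, ∃ P ψ τ lo hi, IsChart Γ C P ψ τ lo hi ∧ ∀ y ∈ Γ, dist y x < r → y ∈ P '' Icc lo hi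

lemma HasCharts.isChordArc {Γ : Set E2} {C r : ℝ} (h : HasCharts Γ C r) (hr : 0 < r)
    (hΓ : IsJordanCurve Γ) (hfin : μH[1] Γ < ⊤) : ∃ c > (1 : ℝ), IsChordArc Γ c := by
  set M := (μH[1] Γ).toReal
  refine ⟨max 2 (max C (M / r)), lt_max_of_lt_left one_lt_two, hΓ, hfin, fun x hx y hy hxy => ?_⟩
  have hd : 0 < dist x y := dist_pos.2 hxy
  by_cases hlt : dist y x < r
  · obtain ⟨P, ψ, τ, lo, hi, hch, hcov⟩ := h x hx
    obtain ⟨s, hs, rfl⟩ := hcov x hx (by simpa)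
    obtain ⟨t, ht, rfl⟩ := hcov y hy hlt
    have hC : C * dist (P s) (P t) ≤ max 2 (max C (M / r)) * dist (P s) (P t) := by
      gcongr; exact (le_max_left _ _).trans (le_max_right _ _)
    rcases lt_trichotomy s t with hst | rfl | hst
    · exact ⟨_, hch.isSubarc hs ht hst,
        (hch.hausdorffMeasure_le hs ht hst.le).trans (ENNReal.ofReal_le_ofReal hC)⟩
    · exact absurd rfl hxy
    · refine ⟨_, (hch.isSubarc ht hs hst).symm,
        (hch.hausdorffMeasure_le ht hs hst.le).trans (ENNReal.ofReal_le_ofReal ?_)⟩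
      rwa [dist_comm]
  · obtain ⟨A, hA⟩ := exists_isSubarc hΓ hx hy hxy
    refine ⟨A, hA, (measure_mono hA.1).trans ?_⟩
    rw [← ENNReal.ofReal_toReal hfin.ne]
    refine ENNReal.ofReal_le_ofReal ?_
    rw [not_lt, dist_comm] at hlt
    calc M = M / r * r := by field_simp
      _ ≤ max 2 (max C (M / r)) * dist x y := by
        gcongr
        exact (le_max_right _ _).trans (le_max_right _ _)

lemma HasCharts.pairFlatness_le {Γ : Set E2} {C r : ℝ} (h : HasCharts Γ C r) (hr : 0 < r)
    {x y : E2} (hx : x ∈ Γ) (hy : y ∈ Γ) (hxy : x ≠ y) (hd : dist x y < r)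
    (hC : C * dist x y ≤ r) : pairFlatness Γ x y ≤ 1 / 2 := by
  obtain ⟨P, ψ, τ, lo, hi, hch, hcov⟩ := h x hx
  obtain ⟨s, hs, rfl⟩ := hcov x hx (by simpa)
  obtain ⟨t, ht, rfl⟩ := hcov y hy (by rwa [dist_comm])
  rcases lt_trichotomy s t with hst | rfl | hst
  · exact hch.pairFlatness_le hcov hs ht hst (Or.inl rfl) hC
  · exact absurd rfl hxy
  · rw [pairFlatness_comm]
    exact hch.pairFlatness_le hcov ht hs hst (Or.inr rfl) (by rwa [dist_comm])

lemma HasCharts.flatness_eq {Γ : Set E2} {C r : ℝ} (h : HasCharts Γ C r) (hr : 0 < r)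
    (hC : 0 < C) (hb : Bornology.IsBounded Γ)
    (hlow : ∀ ε > (0 : ℝ), ∃ x ∈ Γ, ∃ y ∈ Γ, x ≠ y ∧ dist x y ≤ ε ∧ 1 / 2 ≤ pairFlatness Γ x y) :
    flatness Γ = 1 / 2 := by
  set r₁ := min (r / 2) (r / C)
  have hr₁ : 0 < r₁ := lt_min (by positivity) (by positivity)
  have close : ∀ x ∈ Γ, ∀ y ∈ Γ, x ≠ y → dist x y ≤ r₁ → pairFlatness Γ x y ≤ 1 / 2 := by
    intro x hx y hy hxy hd
    refine h.pairFlatness_le hr hx hy hxy ((hd.trans (min_le_left _ _)).trans_lt (by linarith)) ?_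
    calc C * dist x y ≤ C * (r / C) := by gcongr; exact hd.trans (min_le_right _ _)
      _ = r := by field_simp
  have bdd : ∀ ρ : ℝ, BddAbove {h | ∃ x ∈ Γ, ∃ y ∈ Γ, x ≠ y ∧ dist x y ≤ ρ ∧
      h = pairFlatness Γ x y} := by
    intro ρ
    refine ⟨max (1 / 2) (r₁⁻¹ * Metric.diam Γ), ?_⟩
    rintro _ ⟨x, hx, y, hy, hxy, -, rfl⟩
    rcases le_total (dist x y) r₁ with hd | hd
    · exact (close x hx y hy hxy hd).trans (le_max_left _ _)
    · refine ((pairFlatness_le_of_isBounded hb x y).trans ?_).trans (le_max_right _ _)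
      have := Metric.diam_nonneg (s := Γ)
      gcongr
  have low : ∀ ρ > (0 : ℝ), 1 / 2 ≤ sSup {h | ∃ x ∈ Γ, ∃ y ∈ Γ, x ≠ y ∧ dist x y ≤ ρ ∧
      h = pairFlatness Γ x y} := by
    intro ρ hρ
    obtain ⟨x, hx, y, hy, hxy, hd, hle⟩ := hlow ρ hρ
    exact hle.trans (le_csSup (bdd ρ) ⟨x, hx, y, hy, hxy, hd, rfl⟩)
  unfold flatness
  apply le_antisymm
  · refine le_trans (csInf_le ⟨1 / 2, ?_⟩ ⟨r₁, hr₁, rfl⟩) ?_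
    · rintro _ ⟨ρ, hρ, rfl⟩
      exact low ρ hρ
    · refine Real.sSup_le ?_ (by norm_num)
      rintro _ ⟨x, hx, y, hy, hxy, hd, rfl⟩
      exact close x hx y hy hxy hd
  · refine le_csInf ⟨_, r₁, hr₁, rfl⟩ ?_
    rintro _ ⟨ρ, hρ, rfl⟩
    exact low ρ hρ


/-! ### An obstruction to quasisymmetric equivalence with the sphere -/

lemma exists_isPreconnected_sphere (u v : (sphere (0 : E3) 1 : Set E3)) :
    ∃ T : Set (sphere (0 : E3) 1 : Set E3), IsPreconnected T ∧ u ∈ T ∧ v ∈ T ∧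
      ∀ w ∈ T, dist (u : E3) w ≤ 2 * dist (u : E3) v := by
  have hu : ‖(u : E3)‖ = 1 := by simp
  have hv : ‖(v : E3)‖ = 1 := by simp
  suffices H : ∃ T : Set E3, IsPreconnected T ∧ T ⊆ sphere 0 1 ∧ (u : E3) ∈ T ∧ (v : E3) ∈ T ∧
      ∀ w ∈ T, dist (u : E3) w ≤ 2 * dist (u : E3) v by
    obtain ⟨T, hT, hsub, huT, hvT, hd⟩ := H
    refine ⟨Subtype.val ⁻¹' T, ?_, huT, hvT, fun w hw => hd w hw⟩
    rw [← Topology.IsInducing.subtypeVal.isPreconnected_image, Subtype.image_preimage_coe,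
      inter_eq_right.2 hsub]
    exact hT
  rcases lt_or_ge (dist (u : E3) v) 1 with hlt | hge
  · have near : ∀ t ∈ Icc (0 : ℝ) 1, dist (u : E3) ((1 - t) • (u : E3) + t • (v : E3)) ≤
        dist (u : E3) v := by
      intro t ht
      have : (u : E3) - ((1 - t) • (u : E3) + t • (v : E3)) = t • ((u : E3) - v) := by module
      rw [dist_eq_norm, this, norm_smul, Real.norm_of_nonneg ht.1, ← dist_eq_norm]
      exact mul_le_of_le_one_left dist_nonneg ht.2
    have hz : ∀ t ∈ Icc (0 : ℝ) 1, (1 - t) • (u : E3) + t • (v : E3) ≠ 0 := by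
      intro t ht h0
      have := near t ht
      rw [h0, dist_zero_right, hu] at this
      linarith
    refine ⟨(fun t : ℝ => ‖(1 - t) • (u : E3) + t • (v : E3)‖⁻¹ •
      ((1 - t) • (u : E3) + t • (v : E3))) '' Icc 0 1, ?_, ?_, ⟨0, by simp, by simp [hu]⟩,
      ⟨1, by simp, by simp [hv]⟩, ?_⟩
    · have h1 : ContinuousOn (fun t : ℝ => ‖(1 - t) • (u : E3) + t • (v : E3)‖) (Icc 0 1) := by
        fun_prop
      have h2 : ContinuousOn (fun t : ℝ => (1 - t) • (u : E3) + t • (v : E3)) (Icc 0 1) := by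
        fun_prop
      exact isPreconnected_Icc.image _
        ((h1.inv₀ fun t ht => norm_ne_zero_iff.2 (hz t ht)).smul h2)
    · rintro _ ⟨t, ht, rfl⟩
      beta_reduce
      rw [mem_sphere_zero_iff_norm, norm_smul, norm_inv, norm_norm,
        inv_mul_cancel₀ (norm_ne_zero_iff.2 (hz t ht))]
    · rintro _ ⟨t, ht, rfl⟩
      have h1 := near t ht
      have h2 := hz t ht
      beta_reduce
      generalize (1 - t) • (u : E3) + t • (v : E3) = z at h1 h2 ⊢
      have hn : ‖z‖ ≠ 0 := norm_ne_zero_iff.2 h2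
      have h3 : dist z (‖z‖⁻¹ • z) = |‖z‖ - 1| := by
        have : z - ‖z‖⁻¹ • z = (1 - ‖z‖⁻¹) • z := by module
        rw [dist_eq_norm, this, norm_smul, Real.norm_eq_abs, ← abs_of_nonneg (norm_nonneg z),
          ← abs_mul, abs_of_nonneg (norm_nonneg z), sub_mul, inv_mul_cancel₀ hn, one_mul]
      have h4 : |‖z‖ - 1| ≤ dist (u : E3) z := by
        have := abs_norm_sub_norm_le z (u : E3)
        rw [hu] at this
        rwa [dist_comm, dist_eq_norm]
      calc dist (u : E3) (‖z‖⁻¹ • z) ≤ dist (u : E3) z + dist z (‖z‖⁻¹ • z) :=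
            dist_triangle _ _ _
        _ ≤ 2 * dist (u : E3) v := by rw [h3]; linarith
  · refine ⟨sphere 0 1, isPreconnected_sphere (by
      rw [← Module.finrank_eq_rank]; norm_num) 0 1, subset_rfl, u.2, v.2,
      fun w hw => ?_⟩
    have hw' : ‖w‖ = 1 := by simpa using hw
    calc dist (u : E3) w ≤ ‖(u : E3)‖ + ‖w‖ := dist_le_norm_add_norm _ _
      _ ≤ 2 * dist (u : E3) v := by rw [hu, hw']; linarith

/-- On a set quasisymmetrically equivalent to the sphere, any two points lie in a connected
subset whose size is comparable to their distance. -/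
lemma QSEquivSphere.exists_isPreconnected {S : Set E3} (h : QSEquivSphere S) :
    ∃ R > (0 : ℝ), ∀ p q : S, p ≠ q → ∃ E : Set S, IsPreconnected E ∧ p ∈ E ∧ q ∈ E ∧
      ∀ w ∈ E, dist (p : E3) w < R * dist (p : E3) q := by
  obtain ⟨η, ⟨-, hmono, hsurj⟩, f, hf, hqs⟩ := h
  obtain ⟨t, ht0, ht⟩ := hsurj (show (1 / 4 : ℝ) ∈ Ici 0 by norm_num [mem_Ici])
  obtain ⟨t', ht'0, ht'⟩ := hsurj (show (0 : ℝ) ∈ Ici 0 by simp)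
  have htpos : 0 < t := by
    rcases (mem_Ici.1 ht0).eq_or_lt with rfl | hlt
    · have := hmono.monotoneOn ht0 ht'0 ht'0
      linarith
    · exact hlt
  set g := (Equiv.ofBijective f hf).symm
  have hfg : ∀ y, f (g y) = y := (Equiv.ofBijective f hf).apply_symm_apply
  have hgf : ∀ x, g (f x) = x := (Equiv.ofBijective f hf).symm_apply_apply
  refine ⟨t⁻¹, inv_pos.2 htpos, fun p q hpq => ?_⟩
  have hgc : Continuous g := by
    rw [Metric.continuous_iff]
    intro y ε hε
    obtain ⟨b, hb⟩ : ∃ b : S, b ≠ g y := by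
      by_cases hp : p = g y
      · exact ⟨q, fun hq => hpq (hp.trans hq.symm)⟩
      · exact ⟨p, hp⟩
    have hbpos : 0 < dist (f (g y) : E3) (f b) := by
      refine dist_pos.2 fun heq => hb ?_
      exact (hf.1 (Subtype.ext heq)).symm
    have hT : 0 < dist (g y : E3) b / ε := by
      refine div_pos (dist_pos.2 fun heq => hb (Subtype.ext heq).symm) hε
    refine ⟨dist (f (g y) : E3) (f b) / (|η (dist (g y : E3) b / ε)| + 1), by positivity,
      fun a ha => ?_⟩
    by_contra! hle
    have h1 := hqs (g y) b (g a) _ hT (by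
      rw [div_mul_eq_mul_div, le_div_iff₀ hε]
      refine mul_le_mul_of_nonneg_left ?_ dist_nonneg
      rw [dist_comm]; exact hle)
    rw [lt_div_iff₀ (by positivity)] at ha
    rw [hfg, hfg, dist_comm (y : E3) (a : E3)] at h1
    rw [hfg] at ha hbpos
    have h2 : dist (a : E3) y = dist a y := rfl
    have h3 := le_abs_self (η (dist (g y : E3) b / ε))
    rw [h2] at h1
    have h4 := mul_le_mul_of_nonneg_right h3 (dist_nonneg (x := a) (y := y))
    linarith [dist_nonneg (x := a) (y := y)]
  obtain ⟨T, hT, hpT, hqT, hd⟩ := exists_isPreconnected_sphere (f p) (f q)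
  refine ⟨g '' T, hT.image g hgc.continuousOn, ⟨f p, hpT, hgf p⟩, ⟨f q, hqT, hgf q⟩, ?_⟩
  rintro _ ⟨y, hy, rfl⟩
  by_contra! hle
  have h1 := hqs p q (g y) t htpos (by rwa [inv_mul_le_iff₀ htpos] at hle)
  rw [hfg, ht] at h1
  have h2 := hd y hy
  have h3 : 0 < dist (f p : E3) (f q) := dist_pos.2 fun heq => hpq (hf.1 (Subtype.ext heq))
  linarith

lemma abs_coord_sub_le_dist {ι : Type*} [Fintype ι] (p q : EuclideanSpace ℝ ι) (i : ι) :
    |p i - q i| ≤ dist p q := by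
  have := PiLp.norm_apply_le (p - q) i
  rwa [← dist_eq_norm, PiLp.sub_apply, Real.norm_eq_abs] at this

@[simp] lemma mk3_zero (x : E2) (z : ℝ) : mk3 x z 0 = x 0 := rfl

@[simp] lemma mk3_one (x : E2) (z : ℝ) : mk3 x z 1 = x 1 := rfl

@[simp] lemma mk3_two (x : E2) (z : ℝ) : mk3 x z 2 = z := rfl

/-- If the distance to the boundary of `Ω` near the bumps is the distance to the nearest corner,
then the power domes over `Ω` have arbitrarily thin ridges. -/
lemma not_qsEquivSphere_domeSurface {Ω : Set E2}
    (hdist : ∀ n a y, |a| ≤ bumpRadius n → 0 ≤ y → y ≤ bumpRadius n →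
      (!₂[bumpCenter n + a, y] : E2) ∈ closure Ω ∧
      infDist (!₂[bumpCenter n + a, y] : E2) (frontier Ω) = √((bumpRadius n - |a|) ^ 2 + y ^ 2))
    {α : ℝ} (hα0 : 0 < α) (hα1 : α < 1) :
    ¬ QSEquivSphere (domeSurface Ω (fun t => t ^ α)) := by
  intro h
  obtain ⟨R, hR, hE⟩ := h.exists_isPreconnected
  obtain ⟨s, hs0, hs1, hsR⟩ : ∃ s : ℝ, 0 < s ∧ s ≤ 1 / 2 ∧ 4 * s * R ≤ 1 := by
    refine ⟨min (1 / 2) (1 / (4 * R)), by positivity, min_le_left _ _, ?_⟩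
    calc 4 * min (1 / 2) (1 / (4 * R)) * R ≤ 4 * (1 / (4 * R)) * R := by
          gcongr; exact min_le_right _ _
      _ = 1 := by field_simp
  obtain ⟨n, hn⟩ : ∃ n, 8 * R * bumpRadius n ^ (1 - α) < α := by
    have h1 : Filter.Tendsto bumpRadius Filter.atTop (nhds 0) := by
      have := (tendsto_pow_atTop_nhds_zero_of_lt_one (r := (1 / 4 : ℝ)) (by norm_num)
        (by norm_num)).const_mul (1 / 32)
      rwa [mul_zero] at this
    have h2 : Filter.Tendsto (fun n => 8 * R * bumpRadius n ^ (1 - α)) Filter.atTop (nhds 0) := by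
      have := (h1.rpow_const (p := 1 - α) (Or.inr (by linarith))).const_mul (8 * R)
      rwa [Real.zero_rpow (by linarith), mul_zero] at this
    exact (h2.eventually_lt_const hα0).exists
  set r := bumpRadius n
  have hr : 0 < r := bumpRadius_pos n
  have hs2 : s ^ 2 ≤ 1 / 4 := by nlinarith
  have ha : |s ^ 2 * r| ≤ r := by rw [abs_of_nonneg (by positivity)]; nlinarith
  have hy0 : 0 ≤ s * r := by positivity
  have hy1 : s * r ≤ r := by nlinarith
  obtain ⟨hq1, hq2⟩ := hdist n (s ^ 2 * r) (s * r) ha hy0 hy1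
  obtain ⟨hp1, hp2⟩ := hdist n (-(s ^ 2 * r)) (s * r) (by rwa [abs_neg]) hy0 hy1
  rw [abs_neg] at hp2
  rw [abs_of_nonneg (by positivity)] at hp2 hq2
  set d := √((r - s ^ 2 * r) ^ 2 + (s * r) ^ 2)
  have hd : d ≤ r * (1 + -(s ^ 2 / 4)) := by
    refine Real.sqrt_le_iff.2 ⟨by nlinarith, ?_⟩
    have : 0 ≤ r ^ 2 * s ^ 2 * (1 / 2 - 15 / 16 * s ^ 2) := by
      have : 0 ≤ 1 / 2 - 15 / 16 * s ^ 2 := by linarith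
      positivity
    nlinarith
  have hdα : d ^ α ≤ r ^ α * (1 - α * (s ^ 2 / 4)) := by
    calc d ^ α ≤ (r * (1 + -(s ^ 2 / 4))) ^ α :=
          Real.rpow_le_rpow (Real.sqrt_nonneg _) hd hα0.le
      _ = r ^ α * (1 + -(s ^ 2 / 4)) ^ α := Real.mul_rpow hr.le (by linarith)
      _ ≤ r ^ α * (1 + α * -(s ^ 2 / 4)) := by
          gcongr
          exact rpow_one_add_le_one_add_mul_self (by linarith) hα0.le hα1.le
      _ = _ := by ring
  set x₁ : E2 := !₂[bumpCenter n + -(s ^ 2 * r), s * r]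
  set x₂ : E2 := !₂[bumpCenter n + s ^ 2 * r, s * r]
  have hpS : mk3 x₁ (d ^ α) ∈ domeSurface Ω (fun t => t ^ α) :=
    ⟨x₁, hp1, Or.inl (by simp only [hp2])⟩
  have hqS : mk3 x₂ (d ^ α) ∈ domeSurface Ω (fun t => t ^ α) :=
    ⟨x₂, hq1, Or.inl (by simp only [hq2])⟩
  have hpos : 0 < s ^ 2 * r := by positivity
  have hpq : dist (mk3 x₁ (d ^ α)) (mk3 x₂ (d ^ α)) = 2 * (s ^ 2 * r) := by
    rw [EuclideanSpace.dist_eq, Fin.sum_univ_three, Real.dist_eq, Real.dist_eq, Real.dist_eq]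
    simp only [mk3_zero, mk3_one, mk3_two, x₁, x₂, Matrix.cons_val_zero,
      Matrix.cons_val_one, sub_self, abs_zero]
    rw [← Real.sqrt_sq (show 0 ≤ 2 * (s ^ 2 * r) by positivity), sq_abs]
    congr 1
    ring
  obtain ⟨E, hEc, hpE, hqE, hEw⟩ := hE ⟨_, hpS⟩ ⟨_, hqS⟩ (by
    intro heq
    have := congrArg Subtype.val heq
    rw [← dist_eq_zero, hpq] at this
    linarith)
  have hcont : Continuous fun w : domeSurface Ω (fun t => t ^ α) => (w : E3) 0 := by fun_prop
  have hmid : bumpCenter n ∈ (fun w : domeSurface Ω (fun t => t ^ α) => (w : E3) 0) '' E := by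
    refine (hEc.image _ hcont.continuousOn).ordConnected.out ⟨_, hpE, rfl⟩ ⟨_, hqE, rfl⟩ ?_
    simp only [mk3_zero, x₁, x₂, Matrix.cons_val_zero]
    constructor <;> linarith
  obtain ⟨⟨w, x, hx, hw⟩, hwE, hw0⟩ := hmid
  have hlt := hEw _ hwE
  simp only [hpq] at hlt hw0
  have hw1 : w 1 = x 1 := by rcases hw with rfl | rfl <;> simp
  have hwx0 : x 0 = bumpCenter n := by rw [← hw0]; rcases hw with rfl | rfl <;> simp
  have hv := (abs_coord_sub_le_dist (mk3 x₁ (d ^ α)) w 1).trans_lt hlt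
  have hh := (abs_coord_sub_le_dist (mk3 x₁ (d ^ α)) w 2).trans_lt hlt
  simp only [mk3_one, mk3_two, hw1, x₁, Matrix.cons_val_one,
    Matrix.cons_val_fin_one] at hv hh
  have hv' : |s * r - x 1| < s * r / 2 := by
    refine hv.trans_le ?_
    have : 0 ≤ s * r * (1 - 4 * s * R) := mul_nonneg hy0 (by linarith)
    nlinarith
  rw [abs_lt] at hv'
  have hsr : s * r ≤ r / 2 := by nlinarith
  obtain ⟨-, hdx⟩ := hdist n 0 (x 1) (by simpa using hr.le) (by linarith) (by linarith)
  have hxeq : (!₂[bumpCenter n + 0, x 1] : E2) = x := by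
    ext i; fin_cases i <;> simp [hwx0]
  rw [hxeq, abs_zero, sub_zero] at hdx
  have hdr : r ≤ infDist x (frontier Ω) := by
    rw [hdx]; exact Real.le_sqrt_of_sq_le (by nlinarith [sq_nonneg (x 1)])
  have hdrα : r ^ α ≤ infDist x (frontier Ω) ^ α := Real.rpow_le_rpow hr.le hdr hα0.le
  have hrα : 0 < r ^ α := Real.rpow_pos_of_pos hr α
  have hprod : r ^ α * r ^ (1 - α) = r := by
    rw [← Real.rpow_add hr]; simp
  have hup : R * (2 * (s ^ 2 * r)) ≤ r ^ α * (α * (s ^ 2 / 4)) := by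
    have h1 : 0 ≤ s ^ 2 * r ^ α * (α - 8 * R * r ^ (1 - α)) :=
      mul_nonneg (by positivity) (by linarith)
    have h2 : s ^ 2 * r ^ α * (8 * R * r ^ (1 - α)) = 8 * R * s ^ 2 * r := by
      calc s ^ 2 * r ^ α * (8 * R * r ^ (1 - α)) = 8 * R * s ^ 2 * (r ^ α * r ^ (1 - α)) := by
            ring
        _ = _ := by rw [hprod]
    rw [mul_sub, h2] at h1
    linarith
  have hsmall : α * (s ^ 2 / 4) ≤ 1 / 16 :=
    (mul_le_of_le_one_left (by positivity) hα1.le).trans (by linarith)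
  have hsplit : r ^ α * (1 - α * (s ^ 2 / 4)) = r ^ α - r ^ α * (α * (s ^ 2 / 4)) := by ring
  rw [hsplit] at hdα
  rw [abs_lt] at hh
  rcases hw with rfl | rfl
  · simp only [mk3_two] at hh
    linarith [hh.1]
  · simp only [mk3_two] at hh
    have : 0 ≤ d ^ α := Real.rpow_nonneg (Real.sqrt_nonneg _) _
    have := mul_le_mul_of_nonneg_left hsmall hrα.le
    linarith [hh.2]

/-! ### The domain -/

/-- The open unit square, with infinitely many half-discs attached below its bottom side. -/
def bumpDomain : Set E2 := {p | 0 < p 0 ∧ p 0 < 1 ∧ profile (p 0) < p 1 ∧ p 1 < 1}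

/-- The boundary of `bumpDomain`. -/
def bumpCurve : Set E2 :=
  {p | (0 ≤ p 0 ∧ p 0 ≤ 1 ∧ p 1 = profile (p 0)) ∨ (p 0 = 0 ∧ 0 ≤ p 1 ∧ p 1 ≤ 1) ∨
    (p 0 = 1 ∧ 0 ≤ p 1 ∧ p 1 ≤ 1) ∨ (p 1 = 1 ∧ 0 ≤ p 0 ∧ p 0 ≤ 1)}

/-- The open unit square. -/
def openSquare : Set E2 := {p | 0 < p 0 ∧ p 0 < 1 ∧ 0 < p 1 ∧ p 1 < 1}

/-- The map carrying the unit square onto `bumpDomain` along vertical lines. -/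
def bumpMap (p : E2) : E2 := !₂[p 0, profile (p 0) + p 1 * (1 - profile (p 0))]

lemma profile_zero : profile 0 = 0 := profile_eq_zero (Or.inl (by norm_num))

lemma profile_one : profile 1 = 0 := profile_eq_zero (Or.inr (by norm_num))

lemma one_sub_profile_pos (x : ℝ) : 0 < 1 - profile x := by linarith [profile_nonpos x]

@[simp] lemma bumpMap_zero (p : E2) : bumpMap p 0 = p 0 := rfl

@[simp] lemma bumpMap_one (p : E2) :
    bumpMap p 1 = profile (p 0) + p 1 * (1 - profile (p 0)) := rfl

lemma continuous_bumpMap : Continuous bumpMap := by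
  have := continuous_profile
  unfold bumpMap; fun_prop

lemma euclideanPlane_ext {p q : E2} (h0 : p 0 = q 0) (h1 : p 1 = q 1) : p = q := by
  ext i; fin_cases i <;> assumption

/-- The vertical inverse of `bumpMap`. -/
lemma exists_bumpMap_eq (p : E2) :
    ∃ q : E2, bumpMap q = p ∧ q 0 = p 0 ∧ q 1 = (p 1 - profile (p 0)) / (1 - profile (p 0)) := by
  refine ⟨!₂[p 0, (p 1 - profile (p 0)) / (1 - profile (p 0))], ?_, rfl, rfl⟩
  refine euclideanPlane_ext rfl ?_
  have := (one_sub_profile_pos (p 0)).ne'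
  simp only [bumpMap_one, Matrix.cons_val_zero, Matrix.cons_val_one,
    Matrix.cons_val_fin_one]
  field_simp
  ring

lemma injective_bumpMap : Function.Injective bumpMap := by
  intro p q h
  have h0 : bumpMap p 0 = bumpMap q 0 := by rw [h]
  have h1 : bumpMap p 1 = bumpMap q 1 := by rw [h]
  rw [bumpMap_zero, bumpMap_zero] at h0
  rw [bumpMap_one, bumpMap_one, h0] at h1
  exact euclideanPlane_ext h0
    (mul_right_cancel₀ (one_sub_profile_pos (q 0)).ne' (add_left_cancel h1))

lemma bumpMap_image_openSquare : bumpMap '' openSquare = bumpDomain := by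
  ext p
  constructor
  · rintro ⟨q, ⟨h1, h2, h3, h4⟩, rfl⟩
    have := one_sub_profile_pos (q 0)
    refine ⟨h1, h2, ?_, ?_⟩ <;> simp only [bumpMap_one, bumpMap_zero] <;> nlinarith
  · rintro ⟨h1, h2, h3, h4⟩
    have := one_sub_profile_pos (p 0)
    obtain ⟨q, rfl, hq0, hq1⟩ := exists_bumpMap_eq p
    refine ⟨q, ⟨h1, h2, ?_, ?_⟩, rfl⟩
    · rw [hq1]; exact div_pos (by linarith) this
    · rw [hq1, div_lt_one this]; linarith

lemma openSquare_eq : openSquare =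
    (EuclideanSpace.equiv (Fin 2) ℝ).toHomeomorph ⁻¹' univ.pi fun _ => Ioo (0 : ℝ) 1 := by
  ext p
  simp [openSquare, Fin.forall_fin_two, and_assoc]

lemma closure_openSquare :
    closure openSquare = {p | 0 ≤ p 0 ∧ p 0 ≤ 1 ∧ 0 ≤ p 1 ∧ p 1 ≤ 1} := by
  rw [openSquare_eq, ← Homeomorph.preimage_closure, closure_pi_set]
  ext p
  simp [Fin.forall_fin_two, closure_Ioo, Pi.le_def]
  tauto

lemma isOpen_openSquare : IsOpen openSquare := by
  rw [openSquare_eq]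
  exact (isOpen_set_pi finite_univ fun _ _ => isOpen_Ioo).preimage (Homeomorph.continuous _)

lemma convex_openSquare : Convex ℝ openSquare := by
  rintro p ⟨hp1, hp2, hp3, hp4⟩ q ⟨hq1, hq2, hq3, hq4⟩ a b ha hb hab
  have key : ∀ x y : ℝ, x ∈ Ioo (0 : ℝ) 1 → y ∈ Ioo (0 : ℝ) 1 → a * x + b * y ∈ Ioo (0 : ℝ) 1 :=
    fun x y hx hy => convex_Ioo 0 1 hx hy ha hb hab
  have h0 := key _ _ ⟨hp1, hp2⟩ ⟨hq1, hq2⟩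
  have h1 := key _ _ ⟨hp3, hp4⟩ ⟨hq3, hq4⟩
  exact ⟨h0.1, h0.2, h1.1, h1.2⟩

lemma nonempty_openSquare : openSquare.Nonempty :=
  ⟨!₂[1 / 2, 1 / 2], by simp [openSquare]; norm_num⟩

lemma isBounded_of_coord {S : Set E2} {R : ℝ} (h : ∀ p ∈ S, |p 0| ≤ R ∧ |p 1| ≤ R) :
    Bornology.IsBounded S := by
  rw [isBounded_iff_forall_norm_le]
  refine ⟨√(R ^ 2 + R ^ 2), fun p hp => ?_⟩
  obtain ⟨h0, h1⟩ := h p hp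
  rw [EuclideanSpace.norm_eq, Fin.sum_univ_two, Real.norm_eq_abs, Real.norm_eq_abs]
  gcongr

lemma isBounded_openSquare : Bornology.IsBounded openSquare :=
  isBounded_of_coord (R := 1) fun p hp => by
    obtain ⟨h1, h2, h3, h4⟩ := hp
    constructor <;> rw [abs_le] <;> constructor <;> linarith

lemma isOpen_bumpDomain : IsOpen bumpDomain := by
  have := continuous_profile
  have h0 : Continuous fun p : E2 => p 0 := by fun_prop
  have h1 : Continuous fun p : E2 => p 1 := by fun_prop
  exact (isOpen_lt continuous_const h0).inter ((isOpen_lt h0 continuous_const).inter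
    ((isOpen_lt (this.comp h0) h1).inter (isOpen_lt h1 continuous_const)))

lemma closure_bumpDomain :
    closure bumpDomain = {p | 0 ≤ p 0 ∧ p 0 ≤ 1 ∧ profile (p 0) ≤ p 1 ∧ p 1 ≤ 1} := by
  apply subset_antisymm
  · refine closure_minimal (fun p hp => ⟨hp.1.le, hp.2.1.le, hp.2.2.1.le, hp.2.2.2.le⟩) ?_
    have := continuous_profile
    have h0 : Continuous fun p : E2 => p 0 := by fun_prop
    have h1 : Continuous fun p : E2 => p 1 := by fun_prop
    exact (isClosed_le continuous_const h0).inter ((isClosed_le h0 continuous_const).inter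
      ((isClosed_le (this.comp h0) h1).inter (isClosed_le h1 continuous_const)))
  · rintro p ⟨h1, h2, h3, h4⟩
    have := one_sub_profile_pos (p 0)
    obtain ⟨q, rfl, hq0, hq1⟩ := exists_bumpMap_eq p
    rw [← bumpMap_image_openSquare]
    refine image_closure_subset_closure_image continuous_bumpMap ⟨q, ?_, rfl⟩
    rw [closure_openSquare]
    refine ⟨h1, h2, ?_, ?_⟩
    · rw [hq1]; exact div_nonneg (by linarith) this.le
    · rw [hq1, div_le_one this]; linarith

lemma frontier_bumpDomain : frontier bumpDomain = bumpCurve := by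
  rw [isOpen_bumpDomain.frontier_eq, closure_bumpDomain]
  ext p
  simp only [bumpDomain, bumpCurve, mem_sdiff, mem_ofPred_eq, not_and_or, not_lt]
  have hp := profile_nonpos (p 0)
  constructor
  · rintro ⟨⟨h1, h2, h3, h4⟩, h | h | h | h⟩
    · have h0 : p 0 = 0 := by linarith
      rw [h0, profile_zero] at h3
      exact Or.inr (Or.inl ⟨h0, h3, h4⟩)
    · have h0 : p 0 = 1 := by linarith
      rw [h0, profile_one] at h3
      exact Or.inr (Or.inr (Or.inl ⟨h0, h3, h4⟩))
    · exact Or.inl ⟨h1, h2, by linarith⟩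
    · exact Or.inr (Or.inr (Or.inr ⟨by linarith, h1, h2⟩))
  · rintro (⟨h1, h2, h3⟩ | ⟨h1, h2, h3⟩ | ⟨h1, h2, h3⟩ | ⟨h1, h2, h3⟩)
    · exact ⟨⟨h1, h2, h3.ge, by linarith⟩, Or.inr (Or.inr (Or.inl h3.le))⟩
    · exact ⟨⟨h1.ge, by linarith, by linarith, h3⟩, Or.inl h1.le⟩
    · exact ⟨⟨by linarith, h1.le, by linarith, h3⟩, Or.inr (Or.inl h1.ge)⟩
    · exact ⟨⟨h2, h3, by linarith, h1.le⟩, Or.inr (Or.inr (Or.inr h1.ge))⟩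

lemma bumpMap_image_frontier : bumpMap '' frontier openSquare = bumpCurve := by
  rw [← frontier_bumpDomain, isOpen_bumpDomain.frontier_eq, isOpen_openSquare.frontier_eq,
    image_sdiff injective_bumpMap, bumpMap_image_openSquare]
  congr 1
  apply subset_antisymm
  · rw [← bumpMap_image_openSquare]
    exact image_closure_subset_closure_image continuous_bumpMap
  · rw [← bumpMap_image_openSquare]
    refine closure_minimal (image_mono subset_closure) ?_
    exact (isBounded_openSquare.isCompact_closure.image continuous_bumpMap).isClosed

lemma isJordanCurve_bumpCurve : IsJordanCurve bumpCurve := by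
  obtain ⟨h, -, -, hh⟩ := exists_homeomorph_image_interior_closure_frontier_eq_unitBall
    convex_openSquare (by rw [isOpen_openSquare.interior_eq]; exact nonempty_openSquare)
    isBounded_openSquare
  refine ⟨bumpMap ∘ h.symm, (continuous_bumpMap.comp h.symm.continuous).continuousOn,
    (injective_bumpMap.comp h.symm.injective).injOn, ?_⟩
  rw [← hh, ← image_comp, Function.comp_assoc]
  simp [bumpMap_image_frontier]

lemma isBounded_bumpDomain : Bornology.IsBounded bumpDomain :=
  isBounded_of_coord (R := 1) fun p hp => by
    obtain ⟨h1, h2, h3, h4⟩ := hp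
    have := profile_ge (p 0)
    constructor <;> rw [abs_le] <;> constructor <;> linarith

lemma isJordanDomain_bumpDomain : IsJordanDomain bumpDomain := by
  refine ⟨isOpen_bumpDomain, ?_, isBounded_bumpDomain, ?_⟩
  · rw [← bumpMap_image_openSquare]
    exact (convex_openSquare.isConnected nonempty_openSquare).image _
      continuous_bumpMap.continuousOn
  · rw [frontier_bumpDomain]
    exact isJordanCurve_bumpCurve

/-! ### Distance to the boundary near the bumps -/

lemma dist_sq_eq (p q : E2) : dist p q ^ 2 = (p 0 - q 0) ^ 2 + (p 1 - q 1) ^ 2 := by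
  rw [EuclideanSpace.dist_eq, Real.sq_sqrt (by positivity), Fin.sum_univ_two, Real.dist_eq,
    Real.dist_eq, sq_abs, sq_abs]

lemma le_dist_of_sq_le {p q : E2} {x : ℝ} (h : x ≤ (p 0 - q 0) ^ 2 + (p 1 - q 1) ^ 2) :
    √x ≤ dist p q := by
  rw [Real.sqrt_le_left dist_nonneg, dist_sq_eq]; exact h

lemma profile_eq_zero_of_abs_sub_eq {n : ℕ} {x : ℝ} (h : |x - bumpCenter n| = bumpRadius n) :
    profile x = 0 := by
  refine profile_eq_zero_of_not_inBump fun m hm => ?_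
  have hr := bumpRadius_pos n
  by_cases hmn : m = n
  · subst hmn; exact hm.ne h
  · have hc : InBump n (bumpCenter n) := by simpa [InBump] using hr
    linarith [(hm.gap hc hmn).2]

lemma infDist_bumpCurve {n : ℕ} {a y : ℝ} (ha : |a| ≤ bumpRadius n) (hy0 : 0 ≤ y)
    (hy1 : y ≤ bumpRadius n) :
    infDist (!₂[bumpCenter n + a, y] : E2) bumpCurve = √((bumpRadius n - |a|) ^ 2 + y ^ 2) := by
  have hr := bumpRadius_pos n
  have hr' := bumpRadius_le n
  have hc : bumpCenter n = 1 / 2 + 5 * bumpRadius n := rfl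
  obtain ⟨σ, hσ, hσa⟩ : ∃ σ : ℝ, |σ| = 1 ∧ a = σ * |a| := by
    rcases le_total 0 a with h | h
    · exact ⟨1, by simp, by rw [abs_of_nonneg h, one_mul]⟩
    · exact ⟨-1, by simp, by rw [abs_of_nonpos h]; ring⟩
  have hσ2 : σ ^ 2 = 1 := by rw [← sq_abs, hσ, one_pow]
  have hq : (!₂[bumpCenter n + σ * bumpRadius n, 0] : E2) ∈ bumpCurve := by
    have h1 := abs_le.1 hσ.le
    have h2 : profile (bumpCenter n + σ * bumpRadius n) = 0 := by
      refine profile_eq_zero_of_abs_sub_eq (n := n) ?_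
      rw [add_sub_cancel_left, abs_mul, hσ, one_mul, abs_of_pos hr]
    refine Or.inl ⟨?_, ?_, h2.symm⟩
    · change 0 ≤ bumpCenter n + σ * bumpRadius n
      nlinarith
    · change bumpCenter n + σ * bumpRadius n ≤ 1
      nlinarith
  apply le_antisymm
  · refine (infDist_le_dist_of_mem hq).trans (le_of_eq ?_)
    rw [eq_comm, Real.sqrt_eq_iff_eq_sq (by positivity) dist_nonneg, dist_sq_eq]
    change _ = (bumpCenter n + a - (bumpCenter n + σ * bumpRadius n)) ^ 2 + (y - 0) ^ 2
    have : (bumpCenter n + a - (bumpCenter n + σ * bumpRadius n)) ^ 2 =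
        σ ^ 2 * (bumpRadius n - |a|) ^ 2 := by
      conv_lhs => rw [hσa]
      ring
    rw [this, hσ2]; ring
  · refine (le_infDist ⟨_, hq⟩).2 fun w hw => le_dist_of_sq_le ?_
    change (bumpRadius n - |a|) ^ 2 + y ^ 2 ≤ (bumpCenter n + a - w 0) ^ 2 + (y - w 1) ^ 2
    have ha0 := abs_nonneg a
    have ha1 := abs_le.1 ha
    have hsmall : (bumpRadius n - |a|) ^ 2 + y ^ 2 ≤ 1 / 16 := by nlinarith
    rcases hw with ⟨-, -, h1⟩ | ⟨h0, -, -⟩ | ⟨h0, -, -⟩ | ⟨h1, -, -⟩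
    · by_cases hb : InBump n (w 0)
      · rw [hb.onlyBump.1] at h1
        obtain ⟨b, hb'⟩ : ∃ b, w 0 - bumpCenter n = b := ⟨_, rfl⟩
        have hbr : |b| ≤ bumpRadius n := by rw [← hb']; exact le_of_lt hb
        rw [hb'] at h1
        have hw1 : w 1 ≤ 0 := h1 ▸ arcBump_nonpos _ _
        have hcirc : w 1 ^ 2 = bumpRadius n ^ 2 - b ^ 2 := by
          rw [h1, arcBump, neg_sq, Real.sq_sqrt (sub_nonneg.2 (sq_le_sq' ?_ ?_))]
          · exact (abs_le.1 hbr).1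
          · exact (abs_le.1 hbr).2
        have hab : a * b ≤ bumpRadius n * |a| := by
          calc a * b ≤ |a * b| := le_abs_self _
            _ = |a| * |b| := abs_mul _ _
            _ ≤ |a| * bumpRadius n := by gcongr
            _ = _ := mul_comm _ _
        have : bumpCenter n + a - w 0 = a - b := by rw [← hb']; ring
        rw [this]
        nlinarith [sq_abs a, mul_nonneg hy0 (neg_nonneg.2 hw1)]
      · have hb' : bumpRadius n ≤ |w 0 - bumpCenter n| := not_lt.1 hb
        have h2 : bumpRadius n - |a| ≤ |bumpCenter n + a - w 0| := by
          have := abs_sub_abs_le_abs_sub (w 0 - bumpCenter n) a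
          rw [abs_sub_comm (w 0 - bumpCenter n) a] at this
          have h3 : a - (w 0 - bumpCenter n) = bumpCenter n + a - w 0 := by ring
          rw [h3] at this
          linarith
        have h3 : (bumpRadius n - |a|) ^ 2 ≤ (bumpCenter n + a - w 0) ^ 2 := by
          rw [← sq_abs (bumpCenter n + a - w 0)]
          exact pow_le_pow_left₀ (by linarith) h2 2
        have h4 : y ^ 2 ≤ (y - w 1) ^ 2 :=
          pow_le_pow_left₀ hy0 (by linarith [profile_nonpos (w 0)]) 2
        linarith
    · rw [h0]; nlinarith [sq_nonneg (y - w 1)]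
    · rw [h0]; nlinarith [sq_nonneg (y - w 1)]
    · rw [h1]; nlinarith [sq_nonneg (bumpCenter n + a - w 0)]

lemma mem_closure_bumpDomain {n : ℕ} {a y : ℝ} (ha : |a| ≤ bumpRadius n) (hy0 : 0 ≤ y)
    (hy1 : y ≤ bumpRadius n) : (!₂[bumpCenter n + a, y] : E2) ∈ closure bumpDomain := by
  have hr := bumpRadius_pos n
  have hr' := bumpRadius_le n
  have hc : bumpCenter n = 1 / 2 + 5 * bumpRadius n := rfl
  have ha1 := abs_le.1 ha
  rw [closure_bumpDomain]
  refine ⟨?_, ?_, (profile_nonpos _).trans hy0, ?_⟩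
  · change 0 ≤ bumpCenter n + a
    linarith
  · change bumpCenter n + a ≤ 1
    linarith
  · change y ≤ 1
    linarith

/-! ### Charts of the boundary curve -/

lemma dist_le_abs_add_abs (p q : E2) : dist p q ≤ |p 0 - q 0| + |p 1 - q 1| := by
  refine le_of_sq_le_sq ?_ (by positivity)
  rw [dist_sq_eq, add_sq, sq_abs, sq_abs]
  have : 0 ≤ 2 * |p 0 - q 0| * |p 1 - q 1| := by positivity
  linarith

lemma lineMap_mem_lineThrough (p q : E2) (c : ℝ) : AffineMap.lineMap p q c ∈ lineThrough p q :=
  AffineMap.lineMap_mem_affineSpan_pair c p q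

lemma lineMap_coord (p q : E2) (c : ℝ) (i : Fin 2) :
    (AffineMap.lineMap p q c : E2) i = c * (q i - p i) + p i := by
  simp [AffineMap.lineMap_apply]

lemma infDist_lineThrough_le_of_obtuse {p u q : E2}
    (h : (p 0 - u 0) * (q 0 - u 0) + (p 1 - u 1) * (q 1 - u 1) ≤ 0) :
    infDist u (lineThrough p q) ≤ dist p q / 2 := by
  refine (infDist_le_dist_of_mem (lineMap_mem_lineThrough p q (1 / 2))).trans ?_
  refine le_of_sq_le_sq ?_ (by positivity)
  rw [div_pow, dist_sq_eq, dist_sq_eq, lineMap_coord, lineMap_coord]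
  linarith

lemma mul_nonneg_of_abs_add_abs_le {a b : ℝ} (h : |a| + |b| ≤ |a + b|) : 0 ≤ a * b := by
  have h1 : (|a| + |b|) ^ 2 ≤ |a + b| ^ 2 := pow_le_pow_left₀ (by positivity) h 2
  rw [sq_abs, add_sq, sq_abs, sq_abs, mul_assoc, ← abs_mul] at h1
  linarith [abs_nonneg (a * b)]

/-- An arc on which the parameter is the `ℓ¹`-arc length is a chart. -/
lemma isChart_of_l1 {Γ : Set E2} {P : ℝ → E2} {ψ : E2 → ℝ} {lo hi : ℝ} (hP : Continuous P)
    (hψ : Continuous ψ) (hcoord : ∀ t ∈ Icc lo hi, ψ (P t) = t) (hmem : ∀ t ∈ Icc lo hi, P t ∈ Γ)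
    (hl1 : ∀ s t, s ≤ t → |P s 0 - P t 0| + |P s 1 - P t 1| = t - s) :
    IsChart Γ 4 P ψ id lo hi where
  continuous := hP
  continuous_coord := hψ
  coord := hcoord
  mem := hmem
  dist_le s _ t _ hst := (dist_le_abs_add_abs _ _).trans (hl1 s t hst).le
  sub_le s _ t _ hst := by
    have h0 := abs_coord_sub_le_dist (P s) (P t) 0
    have h1 := abs_coord_sub_le_dist (P s) (P t) 1
    have := hl1 s t hst
    simp only [id]
    linarith [dist_nonneg (x := P s) (y := P t)]
  flat s _ u _ t _ hsu hut := by
    have h1 := hl1 s u hsu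
    have h2 := hl1 u t hut
    have h3 := hl1 s t (hsu.trans hut)
    have e0 : P s 0 - P u 0 + (P u 0 - P t 0) = P s 0 - P t 0 := by ring
    have e1 : P s 1 - P u 1 + (P u 1 - P t 1) = P s 1 - P t 1 := by ring
    have m0 : 0 ≤ (P s 0 - P u 0) * (P u 0 - P t 0) := mul_nonneg_of_abs_add_abs_le (by
      have := abs_add_le (P s 1 - P u 1) (P u 1 - P t 1)
      rw [e1] at this
      rw [e0]; linarith)
    have m1 : 0 ≤ (P s 1 - P u 1) * (P u 1 - P t 1) := mul_nonneg_of_abs_add_abs_le (by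
      have := abs_add_le (P s 0 - P u 0) (P u 0 - P t 0)
      rw [e0] at this
      rw [e1]; linarith)
    exact infDist_lineThrough_le_of_obtuse (by linarith)

/-- The lower side. -/
def lowerArc (t : ℝ) : E2 := !₂[t, profile t]

/-- The arc around the lower left corner. -/
def lowerLeftArc (t : ℝ) : E2 := !₂[max t 0, max (-t) 0]

/-- The arc around the lower right corner. -/
def lowerRightArc (t : ℝ) : E2 := !₂[min t 1, max (t - 1) 0]

/-- The arc around the upper left corner. -/
def upperLeftArc (t : ℝ) : E2 := !₂[max (t - 1) 0, min t 1]

/-- The arc around the upper right corner. -/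
def upperRightArc (t : ℝ) : E2 := !₂[min 1 (1 - t), min 1 (1 + t)]

@[simp] lemma lowerArc_zero (t : ℝ) : lowerArc t 0 = t := rfl
@[simp] lemma lowerArc_one (t : ℝ) : lowerArc t 1 = profile t := rfl
@[simp] lemma lowerLeftArc_zero (t : ℝ) : lowerLeftArc t 0 = max t 0 := rfl
@[simp] lemma lowerLeftArc_one (t : ℝ) : lowerLeftArc t 1 = max (-t) 0 := rfl
@[simp] lemma lowerRightArc_zero (t : ℝ) : lowerRightArc t 0 = min t 1 := rfl
@[simp] lemma lowerRightArc_one (t : ℝ) : lowerRightArc t 1 = max (t - 1) 0 := rfl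
@[simp] lemma upperLeftArc_zero (t : ℝ) : upperLeftArc t 0 = max (t - 1) 0 := rfl
@[simp] lemma upperLeftArc_one (t : ℝ) : upperLeftArc t 1 = min t 1 := rfl
@[simp] lemma upperRightArc_zero (t : ℝ) : upperRightArc t 0 = min 1 (1 - t) := rfl
@[simp] lemma upperRightArc_one (t : ℝ) : upperRightArc t 1 = min 1 (1 + t) := rfl

lemma isChart_lowerArc :
    IsChart bumpCurve 4 lowerArc (fun p => p 0) (fun t => t + profileVar t) 0 1 where
  continuous := by
    have := continuous_profile
    unfold lowerArc; fun_prop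
  continuous_coord := by fun_prop
  coord _ _ := rfl
  mem t ht := Or.inl ⟨ht.1, ht.2, rfl⟩
  dist_le s _ t _ hst := by
    have h1 := dist_le_abs_add_abs (lowerArc s) (lowerArc t)
    have h2 := profile_sub_le_profileVar_sub hst
    simp only [lowerArc_zero, lowerArc_one] at h1
    rw [abs_sub_comm, abs_of_nonneg (sub_nonneg.2 hst), abs_sub_comm] at h1
    linarith
  sub_le s _ t _ hst := by
    have h0 := abs_coord_sub_le_dist (lowerArc s) (lowerArc t) 0
    have h1 := abs_coord_sub_le_dist (lowerArc s) (lowerArc t) 1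
    have h2 := profileVar_sub_le hst
    simp only [lowerArc_zero, lowerArc_one] at h0 h1
    rw [abs_sub_comm, abs_of_nonneg (sub_nonneg.2 hst)] at h0
    rw [abs_sub_comm] at h1
    linarith
  flat s _ u _ t _ hsu hut := by
    rcases onlyBump_or_abs_profile_le hsu hut with ⟨k, hs, hu, ht⟩ | ⟨hs, hu, ht⟩
    · refine infDist_lineThrough_le_of_obtuse ?_
      have := thales_arcBump (bumpRadius_pos k) (sub_le_sub_right hsu (bumpCenter k))
        (sub_le_sub_right hut (bumpCenter k))
      simp only [lowerArc_zero, lowerArc_one, hs.1, hu.1, ht.1]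
      simpa using this
    · rcases (hsu.trans hut).eq_or_lt with rfl | hst
      · obtain rfl := le_antisymm hsu hut
        exact infDist_lineThrough_le_of_obtuse (by simp)
      · have hpos := sub_pos.2 hst
        set c := (u - s) / (t - s)
        have hc0 : 0 ≤ c := div_nonneg (by linarith) hpos.le
        have hc1 : c ≤ 1 := (div_le_one hpos).2 (by linarith)
        have hcm : c * (t - s) = u - s := div_mul_cancel₀ _ hpos.ne'
        refine (infDist_le_dist_of_mem (lineMap_mem_lineThrough _ _ c)).trans ?_
        have h1 := dist_le_abs_add_abs (lowerArc u)
          (AffineMap.lineMap (lowerArc s) (lowerArc t) c)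
        have h2 := abs_coord_sub_le_dist (lowerArc s) (lowerArc t) 0
        rw [lineMap_coord, lineMap_coord] at h1
        simp only [lowerArc_zero, lowerArc_one] at h1 h2
        rw [hcm, sub_add_cancel, sub_self, abs_zero, zero_add] at h1
        rw [abs_sub_comm, abs_of_pos hpos] at h2
        rw [abs_of_nonpos (profile_nonpos _)] at hs hu ht
        have hs' := profile_nonpos s
        have hu' := profile_nonpos u
        have ht' := profile_nonpos t
        have h3 : |profile u - (c * (profile t - profile s) + profile s)| ≤ (t - s) / 2 := by
          have e : c * (profile t - profile s) + profile s =
            c * profile t + (1 - c) * profile s := by ring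
          have hc2 : 0 ≤ 1 - c := by linarith
          rw [e, abs_le]
          constructor <;> nlinarith
        linarith

lemma isChart_lowerLeftArc :
    IsChart bumpCurve 4 lowerLeftArc (fun p => p 0 - p 1) id (-1) (1 / 4) := by
  refine isChart_of_l1 (by unfold lowerLeftArc; fun_prop) (by fun_prop) (fun t _ => ?_)
    (fun t ht => ?_) fun s t hst => ?_
  · simp only [lowerLeftArc_zero, lowerLeftArc_one]
    grind
  · rcases le_total t 0 with h | h
    · refine Or.inr (Or.inl ⟨max_eq_right h, le_max_right _ _, ?_⟩)
      exact max_le (by linarith [ht.1]) zero_le_one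
    · have e : lowerLeftArc t 0 = t := max_eq_left h
      refine Or.inl ⟨by rw [e]; exact h, by rw [e]; linarith [ht.2], ?_⟩
      rw [e, profile_eq_zero (Or.inl (by linarith [ht.2]))]
      exact max_eq_right (by linarith)
  · simp only [lowerLeftArc_zero, lowerLeftArc_one]
    grind

lemma isChart_lowerRightArc :
    IsChart bumpCurve 4 lowerRightArc (fun p => p 0 + p 1) id (13 / 16) 2 := by
  refine isChart_of_l1 (by unfold lowerRightArc; fun_prop) (by fun_prop) (fun t _ => ?_)
    (fun t ht => ?_) fun s t hst => ?_
  · simp only [lowerRightArc_zero, lowerRightArc_one]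
    grind
  · rcases le_total 1 t with h | h
    · refine Or.inr (Or.inr (Or.inl ⟨min_eq_right h, le_max_right _ _, ?_⟩))
      exact max_le (by linarith [ht.2]) zero_le_one
    · have e : lowerRightArc t 0 = t := min_eq_left h
      refine Or.inl ⟨by rw [e]; linarith [ht.1], by rw [e]; exact h, ?_⟩
      rw [e, profile_eq_zero (Or.inr (by linarith [ht.1]))]
      exact max_eq_right (by linarith)
  · simp only [lowerRightArc_zero, lowerRightArc_one]
    grind

lemma isChart_upperLeftArc :
    IsChart bumpCurve 4 upperLeftArc (fun p => p 0 + p 1) id 0 2 := by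
  refine isChart_of_l1 (by unfold upperLeftArc; fun_prop) (by fun_prop) (fun t _ => ?_)
    (fun t ht => ?_) fun s t hst => ?_
  · simp only [upperLeftArc_zero, upperLeftArc_one]
    grind
  · rcases le_total 1 t with h | h
    · refine Or.inr (Or.inr (Or.inr ⟨min_eq_right h, le_max_right _ _, ?_⟩))
      exact max_le (by linarith [ht.2]) zero_le_one
    · refine Or.inr (Or.inl ⟨max_eq_right (by linarith), ?_, min_le_right _ _⟩)
      exact le_min ht.1 zero_le_one
  · simp only [upperLeftArc_zero, upperLeftArc_one]
    grind

lemma isChart_upperRightArc :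
    IsChart bumpCurve 4 upperRightArc (fun p => p 1 - p 0) id (-1) 1 := by
  refine isChart_of_l1 (by unfold upperRightArc; fun_prop) (by fun_prop) (fun t _ => ?_)
    (fun t ht => ?_) fun s t hst => ?_
  · simp only [upperRightArc_zero, upperRightArc_one]
    grind
  · rcases le_total t 0 with h | h
    · refine Or.inr (Or.inr (Or.inl ⟨min_eq_left (by linarith), ?_, min_le_left _ _⟩))
      exact le_min zero_le_one (by linarith [ht.1])
    · refine Or.inr (Or.inr (Or.inr ⟨min_eq_left (by linarith), ?_, min_le_left _ _⟩))
      exact le_min zero_le_one (by linarith [ht.2])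
  · simp only [upperRightArc_zero, upperRightArc_one]
    grind

lemma mem_upperLeftArc {y : E2} (h : (y 0 = 0 ∧ 0 ≤ y 1 ∧ y 1 ≤ 1) ∨
    (y 1 = 1 ∧ 0 ≤ y 0 ∧ y 0 ≤ 1)) : y ∈ upperLeftArc '' Icc 0 2 := by
  refine ⟨y 0 + y 1, ?_, ?_⟩
  · rcases h with ⟨h0, h1, h2⟩ | ⟨h0, h1, h2⟩ <;> constructor <;> linarith
  · rcases h with ⟨h0, h1, h2⟩ | ⟨h0, h1, h2⟩ <;> refine euclideanPlane_ext ?_ ?_ <;>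
      simp only [upperLeftArc_zero, upperLeftArc_one, max_def, min_def] <;> split_ifs <;> linarith

lemma mem_upperRightArc {y : E2} (h : (y 0 = 1 ∧ 0 ≤ y 1 ∧ y 1 ≤ 1) ∨
    (y 1 = 1 ∧ 0 ≤ y 0 ∧ y 0 ≤ 1)) : y ∈ upperRightArc '' Icc (-1) 1 := by
  refine ⟨y 1 - y 0, ?_, ?_⟩
  · rcases h with ⟨h0, h1, h2⟩ | ⟨h0, h1, h2⟩ <;> constructor <;> linarith
  · rcases h with ⟨h0, h1, h2⟩ | ⟨h0, h1, h2⟩ <;> refine euclideanPlane_ext ?_ ?_ <;>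
      simp only [upperRightArc_zero, upperRightArc_one, min_def] <;> split_ifs <;> linarith

lemma mem_lowerArc {y : E2} (h : 0 ≤ y 0 ∧ y 0 ≤ 1 ∧ y 1 = profile (y 0)) :
    y ∈ lowerArc '' Icc 0 1 :=
  ⟨y 0, ⟨h.1, h.2.1⟩, euclideanPlane_ext rfl h.2.2.symm⟩

lemma upperRightArc_covers {x y : E2} (hx0 : 1 / 2 < x 0) (hx1 : 1 / 2 ≤ x 1)
    (hy : y ∈ bumpCurve) (hxy : dist y x < 1 / 16) : y ∈ upperRightArc '' Icc (-1) 1 := by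
  have d0 := abs_lt.1 ((abs_coord_sub_le_dist y x 0).trans_lt hxy)
  have d1 := abs_lt.1 ((abs_coord_sub_le_dist y x 1).trans_lt hxy)
  apply mem_upperRightArc
  rcases hy with h | h | h | h
  · linarith [profile_nonpos (y 0)]
  · linarith
  · exact Or.inl h
  · exact Or.inr h

lemma hasCharts_bumpCurve : HasCharts bumpCurve 4 (1 / 16) := by
  intro x hx
  rcases le_or_gt (1 / 2) (x 1) with hx1 | hx1
  · rcases le_or_gt (x 0) (1 / 2) with hx0 | hx0
    · refine ⟨_, _, _, _, _, isChart_upperLeftArc, fun y hy hxy => mem_upperLeftArc ?_⟩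
      have d0 := abs_lt.1 ((abs_coord_sub_le_dist y x 0).trans_lt hxy)
      have d1 := abs_lt.1 ((abs_coord_sub_le_dist y x 1).trans_lt hxy)
      rcases hy with h | h | h | h
      · linarith [profile_nonpos (y 0)]
      · exact Or.inl h
      · linarith
      · exact Or.inr h
    · exact ⟨_, _, _, _, _, isChart_upperRightArc, fun y hy hxy =>
        upperRightArc_covers hx0 hx1 hy hxy⟩
  · rcases lt_or_ge (x 0) (1 / 8) with hx0 | hx0
    · refine ⟨_, _, _, _, _, isChart_lowerLeftArc, fun y hy hxy => ⟨y 0 - y 1, ?_⟩⟩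
      have d0 := abs_lt.1 ((abs_coord_sub_le_dist y x 0).trans_lt hxy)
      have d1 := abs_lt.1 ((abs_coord_sub_le_dist y x 1).trans_lt hxy)
      rcases hy with ⟨h0, h1, h2⟩ | ⟨h0, h1, h2⟩ | h | h
      · rw [profile_eq_zero (Or.inl (by linarith))] at h2
        refine ⟨⟨by linarith, by linarith⟩, euclideanPlane_ext ?_ ?_⟩ <;>
          simp only [lowerLeftArc_zero, lowerLeftArc_one, max_def] <;> split_ifs <;> linarith
      · refine ⟨⟨by linarith, by linarith⟩, euclideanPlane_ext ?_ ?_⟩ <;>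
          simp only [lowerLeftArc_zero, lowerLeftArc_one, max_def] <;> split_ifs <;> linarith
      · linarith
      · linarith
    · rcases le_or_gt (x 0) (7 / 8) with hx0' | hx0'
      · refine ⟨_, _, _, _, _, isChart_lowerArc, fun y hy hxy => ?_⟩
        have d0 := abs_lt.1 ((abs_coord_sub_le_dist y x 0).trans_lt hxy)
        have d1 := abs_lt.1 ((abs_coord_sub_le_dist y x 1).trans_lt hxy)
        rcases hy with h | h | h | h
        · exact mem_lowerArc h
        · linarith
        · linarith
        · linarith
      · refine ⟨_, _, _, _, _, isChart_lowerRightArc, fun y hy hxy => ⟨y 0 + y 1, ?_⟩⟩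
        have d0 := abs_lt.1 ((abs_coord_sub_le_dist y x 0).trans_lt hxy)
        have d1 := abs_lt.1 ((abs_coord_sub_le_dist y x 1).trans_lt hxy)
        rcases hy with ⟨h0, h1, h2⟩ | h | ⟨h0, h1, h2⟩ | h
        · rw [profile_eq_zero (Or.inr (by linarith))] at h2
          refine ⟨⟨by linarith, by linarith⟩, euclideanPlane_ext ?_ ?_⟩ <;>
            simp only [lowerRightArc_zero, lowerRightArc_one, max_def, min_def] <;> split_ifs <;> linarith
        · linarith
        · refine ⟨⟨by linarith, by linarith⟩, euclideanPlane_ext ?_ ?_⟩ <;>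
            simp only [lowerRightArc_zero, lowerRightArc_one, max_def, min_def] <;> split_ifs <;> linarith
        · linarith

lemma hausdorffMeasure_bumpCurve_lt_top : μH[1] bumpCurve < ⊤ := by
  have hsub : bumpCurve ⊆ lowerArc '' Icc 0 1 ∪
      (upperLeftArc '' Icc 0 2 ∪ upperRightArc '' Icc (-1) 1) := by
    rintro y (h | h | h | h)
    · exact Or.inl (mem_lowerArc h)
    · exact Or.inr (Or.inl (mem_upperLeftArc (Or.inl h)))
    · exact Or.inr (Or.inr (mem_upperRightArc (Or.inl h)))
    · exact Or.inr (Or.inl (mem_upperLeftArc (Or.inr h)))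
  refine (measure_mono hsub).trans_lt (measure_union_lt_top ?_ (measure_union_lt_top ?_ ?_))
  · exact (isChart_lowerArc.hausdorffMeasure_le (by simp) (by simp) (by norm_num)).trans_lt
      ENNReal.ofReal_lt_top
  · exact (isChart_upperLeftArc.hausdorffMeasure_le (by simp) (by simp) (by norm_num)).trans_lt
      ENNReal.ofReal_lt_top
  · exact (isChart_upperRightArc.hausdorffMeasure_le (by simp) (by simp) (by norm_num)).trans_lt
      ENNReal.ofReal_lt_top

lemma half_le_pairFlatness_upperRightArc {e : ℝ} (he0 : 0 < e) (he : e ≤ 1 / 256) :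
    1 / 2 ≤ pairFlatness bumpCurve (upperRightArc (-e)) (upperRightArc e) := by
  have a0 : upperRightArc (-e) 0 = 1 := min_eq_left (by linarith)
  have a1 : upperRightArc (-e) 1 = 1 - e := (min_eq_right (by linarith)).trans (by ring)
  have b0 : upperRightArc e 0 = 1 - e := min_eq_right (by linarith)
  have b1 : upperRightArc e 1 = 1 := min_eq_left (by linarith)
  have c0 : upperRightArc 0 0 = 1 := by simp
  have c1 : upperRightArc 0 1 = 1 := by simp
  have hd : dist (upperRightArc (-e)) (upperRightArc e) ^ 2 = 2 * e ^ 2 := by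
    rw [dist_sq_eq, a0, a1, b0, b1]; ring
  have hd' : dist (upperRightArc (-e)) (upperRightArc e) ≤ 2 * e :=
    le_of_sq_le_sq (by rw [hd]; nlinarith) (by positivity)
  refine isChart_upperRightArc.le_pairFlatness (r := 1 / 16) (u := 0) (fun y hy hxy =>
    upperRightArc_covers (x := upperRightArc (-e)) ?_ ?_ hy hxy) ?_ ?_ ?_ (Or.inl rfl) ?_ ?_ ?_
  · rw [a0]; norm_num
  · rw [a1]; linarith
  · constructor <;> linarith
  · constructor <;> linarith
  · linarith
  · constructor <;> linarith
  · linarith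
  · refine (le_infDist ⟨_, left_mem_lineThrough _ _⟩).2 fun w hw => ?_
    obtain ⟨c, rfl⟩ := mem_affineSpan_pair_iff_exists_lineMap_eq.1 hw
    refine le_of_sq_le_sq ?_ dist_nonneg
    rw [div_pow, hd, dist_sq_eq, lineMap_coord, lineMap_coord, a0, a1, b0, b1, c0, c1]
    nlinarith [sq_nonneg (c * e - (1 - c) * e)]

lemma flatness_bumpCurve : flatness bumpCurve = 1 / 2 := by
  refine hasCharts_bumpCurve.flatness_eq (by norm_num) (by norm_num) ?_ fun ε hε => ?_
  · rw [← frontier_bumpDomain]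
    exact isBounded_bumpDomain.closure.subset frontier_subset_closure
  · set e := min (ε / 2) (1 / 256)
    have he0 : 0 < e := lt_min (by positivity) (by norm_num)
    have he1 : e ≤ ε / 2 := min_le_left _ _
    have he2 : e ≤ 1 / 256 := min_le_right _ _
    have m1 : -e ∈ Icc (-1 : ℝ) 1 := ⟨by linarith, by linarith⟩
    have m2 : e ∈ Icc (-1 : ℝ) 1 := ⟨by linarith, by linarith⟩
    refine ⟨_, isChart_upperRightArc.mem _ m1, _, isChart_upperRightArc.mem _ m2, fun heq => ?_,
      ?_, half_le_pairFlatness_upperRightArc he0 he2⟩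
    · linarith [isChart_upperRightArc.injOn m1 m2 heq]
    · refine (isChart_upperRightArc.dist_le _ m1 _ m2 (by linarith)).trans ?_
      simp only [id]
      linarith

/-- Corollary 1.4 (second part): there is a Jordan domain with chord-arc boundary of
flatness exactly 1/2 for which Σ(Ω, t^α) is not quasisymmetric to S² for any α ∈ (0,1). -/
theorem stmt2 : ∃ Ω : Set E2, IsJordanDomain Ω ∧
    (∃ c > (1:ℝ), IsChordArc (frontier Ω) c) ∧
    flatness (frontier Ω) = 1 / 2 ∧
    ∀ α : ℝ, 0 < α → α < 1 → ¬ QSEquivSphere (domeSurface Ω (fun t => t ^ α)) := by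
  refine ⟨bumpDomain, isJordanDomain_bumpDomain, ?_, ?_, fun α h0 h1 =>
    not_qsEquivSphere_domeSurface
      (fun n a y ha hy0 hy1 => ⟨mem_closure_bumpDomain ha hy0 hy1, ?_⟩) h0 h1⟩
  · rw [frontier_bumpDomain]
    exact hasCharts_bumpCurve.isChordArc (by norm_num) isJordanCurve_bumpCurve
      hausdorffMeasure_bumpCurve_lt_top
  · rw [frontier_bumpDomain]
    exact flatness_bumpCurve
  · rw [frontier_bumpDomain]
    exact infDist_bumpCurve ha hy0 hy1
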